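/- Parameter-uniform first-order convergence (main theorem): Let u=(u₁,u₂)ᵀ with u₁,u₂ ∈ C³([0,1]) solve Lu = f on (0,1) with u(0)=l, u(1)=r, and let U=(U₁,U₂)ᵀ be the mesh function on the Shishkin mesh satisfying (L^N U)(x_j)=f(x_j) for 1 ≤ j ≤ N−1, U(x₀)=l, U(x_N)=r. Then there is a constant C, independent of ε₁, ε₂ and N (depending only on α, β, the coefficient functions, f, l and r), such that max_{0≤j≤N} max{|U₁(x_j)−u₁(x_j)|, |U₂(x_j)−u₂(x_j)|} ≤ C N⁻¹ ln N. -/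

import Mathlib

open Set

/-- Forward difference quotient on a mesh. -/
noncomputable def Dp (x U : ℕ → ℝ) (j : ℕ) : ℝ := (U (j+1) - U j) / (x (j+1) - x j)

/-- Backward difference quotient on a mesh. -/
noncomputable def Dm (x U : ℕ → ℝ) (j : ℕ) : ℝ := (U j - U (j-1)) / (x j - x (j-1))

/-- Discrete second-order central difference on a mesh. -/
noncomputable def delta2 (x U : ℕ → ℝ) (j : ℕ) : ℝ :=
  (Dp x U j - Dm x U j) / ((x (j+1) - x (j-1)) / 2)

/-- First component of the discrete operator L^N. -/
noncomputable def LN1 (ε : ℝ) (a b₁₁ b₁₂ : ℝ → ℝ) (x Ψ₁ Ψ₂ : ℕ → ℝ) (j : ℕ) : ℝ :=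
  ε * delta2 x Ψ₁ j + a (x j) * Dp x Ψ₁ j - b₁₁ (x j) * Ψ₁ j + b₁₂ (x j) * Ψ₂ j

/-- Second component of the discrete operator L^N. -/
noncomputable def LN2 (ε : ℝ) (a b₂₂ b₂₁ : ℝ → ℝ) (x Ψ₁ Ψ₂ : ℕ → ℝ) (j : ℕ) : ℝ :=
  ε * delta2 x Ψ₂ j + a (x j) * Dp x Ψ₂ j - b₂₂ (x j) * Ψ₂ j + b₂₁ (x j) * Ψ₁ j

/-- The piecewise-uniform Shishkin mesh on [0,1] with transition parameters
τ₂ = min{1/2, (2ε₂/α) ln N} and τ₁ = min{τ₂/2, (2ε₁/α) ln N}. -/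
noncomputable def shMesh (N : ℕ) (α ε₁ ε₂ : ℝ) (j : ℕ) : ℝ :=
  let τ₂ : ℝ := min (1/2) ((2 * ε₂ / α) * Real.log (N : ℝ))
  let τ₁ : ℝ := min (τ₂ / 2) ((2 * ε₁ / α) * Real.log (N : ℝ))
  if j ≤ N / 4 then (j : ℝ) * (4 * τ₁ / N)
  else if j ≤ N / 2 then τ₁ + ((j : ℝ) - (N : ℝ) / 4) * (4 * (τ₂ - τ₁) / N)
  else τ₂ + ((j : ℝ) - (N : ℝ) / 2) * (2 * (1 - τ₂) / N)

lemma abs_sub_le_of_abs_deriv_le {φ φ' B B' : ℝ → ℝ} {s t : ℝ} (hst : s ≤ t)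
    (hφ : ∀ y ∈ Icc s t, HasDerivAt φ (φ' y) y) (hB : ∀ y ∈ Icc s t, HasDerivAt B (B' y) y)
    (h : ∀ y ∈ Icc s t, |φ' y| ≤ B' y) : |φ t - φ s| ≤ B t - B s := by
  have key : ∀ {F F' : ℝ → ℝ}, (∀ y ∈ Icc s t, HasDerivAt F (F' y) y) →
      (∀ y ∈ Icc s t, 0 ≤ F' y) → F s ≤ F t := by
    intro F F' hF hF'
    refine monotoneOn_of_deriv_nonneg (convex_Icc s t)
      (fun y hy => (hF y hy).continuousAt.continuousWithinAt)
      (fun y hy => (hF y (interior_subset hy)).differentiableAt.differentiableWithinAt)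
      (fun y hy => ?_) (left_mem_Icc.2 hst) (right_mem_Icc.2 hst) hst
    rw [(hF y (interior_subset hy)).deriv]
    exact hF' y (interior_subset hy)
  have h1 := key (F := fun y => B y - φ y) (fun y hy => (hB y hy).sub (hφ y hy))
    (fun y hy => sub_nonneg.2 ((le_abs_self _).trans (h y hy)))
  have h2 := key (F := fun y => B y + φ y) (fun y hy => (hB y hy).add (hφ y hy))
    (fun y hy => by linarith [neg_abs_le (φ' y), h y hy])
  rw [abs_le]
  constructor <;> linarith

lemma deriv_deriv_nonpos_of_isLocalMax {u : ℝ → ℝ} {x : ℝ} (hu : Continuous u)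
    (h : IsLocalMax u x) : deriv (deriv u) x ≤ 0 := by
  by_contra! hpos
  have hmin : IsLocalMin u x :=
    isLocalMin_of_deriv_deriv_pos hpos h.deriv_eq_zero hu.continuousAt
  have hconst : u =ᶠ[nhds x] fun _ => u x := by
    filter_upwards [h, hmin] with y h1 h2 using le_antisymm h1 h2
  have := hconst.deriv.deriv_eq
  simp at this
  linarith

/-- Interior bound behind the maximum principle: a component attaining the largest value of the
pair at an interior point is controlled by the data. -/
lemma mul_le_of_isMax_interior {ε β M : ℝ} {a b c f u v : ℝ → ℝ} {x : ℝ} (hε : 0 < ε)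
    (hx : x ∈ Ioo (0:ℝ) 1) (hu : Continuous u)
    (hmax : ∀ y ∈ Icc (0:ℝ) 1, u y ≤ u x) (hv : v x ≤ u x) (h0 : 0 ≤ u x)
    (hb : β ≤ b x - c x) (hc : 0 < c x) (hf : |f x| ≤ M)
    (heq : ε * deriv (deriv u) x + a x * deriv u x - b x * u x + c x * v x = f x) :
    β * u x ≤ M := by
  have hloc : IsLocalMax u x := by
    filter_upwards [Icc_mem_nhds hx.1 hx.2] with y hy using hmax y hy
  have h2 := deriv_deriv_nonpos_of_isLocalMax hu hloc
  rw [hloc.deriv_eq_zero] at heq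
  have h3 := mul_nonneg hε.le (neg_nonneg.2 h2)
  have h4 := mul_le_mul_of_nonneg_left hv hc.le
  have h5 := mul_le_mul_of_nonneg_right hb h0
  linarith [neg_abs_le (f x)]

lemma mul_abs_le_of_isMax_interior {ε β M : ℝ} {a b c f u v : ℝ → ℝ} {x : ℝ} (hε : 0 < ε)
    (hx : x ∈ Ioo (0:ℝ) 1) (hu : Continuous u)
    (hmax : ∀ y ∈ Icc (0:ℝ) 1, |u y| ≤ |u x|) (hv : |v x| ≤ |u x|)
    (hb : β ≤ b x - c x) (hc : 0 < c x) (hf : |f x| ≤ M)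
    (heq : ε * deriv (deriv u) x + a x * deriv u x - b x * u x + c x * v x = f x) :
    β * |u x| ≤ M := by
  rcases le_total 0 (u x) with h0 | h0
  · rw [abs_of_nonneg h0] at hmax hv ⊢
    exact mul_le_of_isMax_interior hε hx hu (fun y hy => (le_abs_self _).trans (hmax y hy))
      ((le_abs_self _).trans hv) h0 hb hc hf heq
  · rw [abs_of_nonpos h0] at hmax hv ⊢
    have hd : deriv (fun y => -u y) = fun y => -deriv u y := by
      funext y; exact deriv.fun_neg
    refine mul_le_of_isMax_interior (u := fun y => -u y) (v := fun y => -v y)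
      (f := fun y => -f y) (a := a) hε hx hu.neg
      (fun y hy => (neg_le_abs _).trans (hmax y hy))
      ((neg_le_abs _).trans hv) (by simpa using h0) hb hc (by simpa using hf) ?_
    rw [hd, deriv.fun_neg]
    linarith

/-- A priori bound for the solution of the continuous system. -/
lemma abs_solution_le {β ε₁ ε₂ M K : ℝ} {a₁ a₂ b₁₁ b₁₂ b₂₁ b₂₂ f₁ f₂ u₁ u₂ : ℝ → ℝ}
    (hβ : 0 < β) (hε₁ : 0 < ε₁) (hε₂ : 0 < ε₂) (hu₁ : Continuous u₁) (hu₂ : Continuous u₂)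
    (hb₁ : ∀ x ∈ Icc (0:ℝ) 1, β ≤ b₁₁ x - b₁₂ x)
    (hb₂ : ∀ x ∈ Icc (0:ℝ) 1, β ≤ b₂₂ x - b₂₁ x)
    (hb₁₂ : ∀ x ∈ Icc (0:ℝ) 1, 0 < b₁₂ x) (hb₂₁ : ∀ x ∈ Icc (0:ℝ) 1, 0 < b₂₁ x)
    (hf₁ : ∀ x ∈ Icc (0:ℝ) 1, |f₁ x| ≤ M) (hf₂ : ∀ x ∈ Icc (0:ℝ) 1, |f₂ x| ≤ M)
    (heq : ∀ x ∈ Ioo (0:ℝ) 1,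
      ε₁ * deriv (deriv u₁) x + a₁ x * deriv u₁ x - b₁₁ x * u₁ x + b₁₂ x * u₂ x = f₁ x ∧
      ε₂ * deriv (deriv u₂) x + a₂ x * deriv u₂ x - b₂₂ x * u₂ x + b₂₁ x * u₁ x = f₂ x)
    (h₁0 : |u₁ 0| ≤ K) (h₂0 : |u₂ 0| ≤ K) (h₁1 : |u₁ 1| ≤ K) (h₂1 : |u₂ 1| ≤ K)
    (hK : M / β ≤ K) :
    ∀ x ∈ Icc (0:ℝ) 1, |u₁ x| ≤ K ∧ |u₂ x| ≤ K := by
  obtain ⟨x, hx, hmax⟩ := isCompact_Icc.exists_isMaxOn (nonempty_Icc.2 (zero_le_one' ℝ))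
    (hu₁.abs.max hu₂.abs).continuousOn
  have hle : max |u₁ x| |u₂ x| ≤ K := by
    by_cases hxi : x ∈ Ioo (0:ℝ) 1
    · rw [div_le_iff₀' hβ] at hK
      rcases le_total |u₂ x| |u₁ x| with h | h
      · rw [max_eq_left h]
        refine le_of_mul_le_mul_left (le_trans ?_ hK) hβ
        exact mul_abs_le_of_isMax_interior hε₁ hxi hu₁
          (fun y hy => (le_max_left _ _).trans ((hmax hy).trans (max_eq_left h).le)) h
          (hb₁ x hx) (hb₁₂ x hx) (hf₁ x hx) (heq x hxi).1
      · rw [max_eq_right h]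
        refine le_of_mul_le_mul_left (le_trans ?_ hK) hβ
        exact mul_abs_le_of_isMax_interior hε₂ hxi hu₂
          (fun y hy => (le_max_right _ _).trans ((hmax hy).trans (max_eq_right h).le)) h
          (hb₂ x hx) (hb₂₁ x hx) (hf₂ x hx) (heq x hxi).2
    · have : x = 0 ∨ x = 1 := by
        by_contra! hne
        exact hxi ⟨lt_of_le_of_ne hx.1 hne.1.symm, lt_of_le_of_ne hx.2 hne.2⟩
      rcases this with rfl | rfl
      · exact max_le h₁0 h₂0
      · exact max_le h₁1 h₂1
  intro y hy
  exact max_le_iff.1 ((hmax hy).trans hle)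

/-- Boundary-layer bound for the first derivative of a scalar convection-diffusion solution. -/
lemma abs_deriv_le_layer {α ε A A' G K : ℝ} {a g u : ℝ → ℝ} (hα : 0 < α) (hε : 0 < ε)
    (hε1 : ε ≤ 1) (hu : Differentiable ℝ u) (hu' : Differentiable ℝ (deriv u))
    (ha' : Differentiable ℝ a)
    (ha : ∀ x ∈ Icc (0:ℝ) 1, α ≤ a x) (hA : ∀ x ∈ Icc (0:ℝ) 1, |a x| ≤ A)
    (hA' : ∀ x ∈ Icc (0:ℝ) 1, |deriv a x| ≤ A') (hG : ∀ x ∈ Icc (0:ℝ) 1, |g x| ≤ G)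
    (hK : ∀ x ∈ Icc (0:ℝ) 1, |u x| ≤ K)
    (heq : ∀ x ∈ Icc (0:ℝ) 1, ε * deriv (deriv u) x + a x * deriv u x = g x) :
    ∀ x ∈ Icc (0:ℝ) 1, |deriv u x| ≤
      (2 * K + 2 * (A * K) + G + A' * K) * (ε⁻¹ * Real.exp (-(α * x / ε))) + (G + 1) / α := by
  have m0 : (0:ℝ) ∈ Icc (0:ℝ) 1 := by simp
  have m1 : (1:ℝ) ∈ Icc (0:ℝ) 1 := by simp
  set Q := 2 * K + 2 * (A * K) + G + A' * K with hQ
  have hA0 : 0 ≤ A := (abs_nonneg _).trans (hA 0 m0)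
  have hau : ∀ x ∈ Icc (0:ℝ) 1, |a x * u x| ≤ A * K := fun x hx => by
    rw [abs_mul]; exact mul_le_mul (hA x hx) (hK x hx) (abs_nonneg _) hA0
  have hp0 : ε * |deriv u 0| ≤ Q := by
    obtain ⟨ξ, hξ, hmv⟩ := exists_deriv_eq_slope u zero_lt_one hu.continuous.continuousOn
      hu.differentiableOn
    have hξ' : ξ ∈ Icc (0:ℝ) 1 := Ioo_subset_Icc_self hξ
    have hpξ : |deriv u ξ| ≤ 2 * K := by
      rw [hmv, sub_zero, div_one]
      linarith [abs_sub (u 1) (u 0), hK 0 m0, hK 1 m1]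
    have hpξ' : ε * |deriv u ξ| ≤ 2 * K :=
      (mul_le_of_le_one_left (abs_nonneg _) hε1).trans hpξ
    have hψ := abs_sub_le_of_abs_deriv_le (s := 0) (t := ξ)
      (φ := fun y => ε * deriv u y + a y * u y)
      (φ' := fun y => ε * deriv (deriv u) y + (deriv a y * u y + a y * deriv u y))
      (B := fun y => (G + A' * K) * y) (B' := fun _ => G + A' * K) hξ'.1
      (fun y _ => ((hu' y).hasDerivAt.const_mul ε).add
        ((ha' y).hasDerivAt.mul (hu y).hasDerivAt))
      (fun y _ => by simpa using (hasDerivAt_id y).const_mul (G + A' * K))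
      (fun y hy => by
        have hy' : y ∈ Icc (0:ℝ) 1 := ⟨hy.1, hy.2.trans hξ'.2⟩
        have e : ε * deriv (deriv u) y + (deriv a y * u y + a y * deriv u y)
            = g y + deriv a y * u y := by linarith [heq y hy']
        rw [e]
        refine (abs_add_le _ _).trans (add_le_add (hG y hy') ?_)
        rw [abs_mul]
        exact mul_le_mul (hA' y hy') (hK y hy') (abs_nonneg _)
          ((abs_nonneg _).trans (hA' y hy')))
    have hGA : 0 ≤ G + A' * K := add_nonneg ((abs_nonneg _).trans (hG 0 m0))
      (mul_nonneg ((abs_nonneg _).trans (hA' 0 m0)) ((abs_nonneg _).trans (hK 0 m0)))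
    have hψ' : (G + A' * K) * ξ ≤ G + A' * K := mul_le_of_le_one_right hGA hξ'.2
    simp only [mul_zero, sub_zero] at hψ
    have habs : ∀ y : ℝ, ε * |y| = |ε * y| := fun y => by rw [abs_mul, abs_of_pos hε]
    rw [habs] at hpξ' ⊢
    have h1 := abs_le.1 (hau 0 m0)
    have h2 := abs_le.1 (hau ξ hξ')
    have h3 := abs_le.1 hψ
    have h4 := abs_le.1 hpξ'
    rw [abs_le]
    constructor <;> linarith
  have hQ0 : 0 ≤ Q := (mul_nonneg hε.le (abs_nonneg _)).trans hp0
  have hp0' : |deriv u 0| ≤ Q * ε⁻¹ := by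
    rw [← div_eq_mul_inv, le_div_iff₀' hε]; exact hp0
  have hG0 : 0 ≤ G := (abs_nonneg _).trans (hG 0 m0)
  have hB : ∀ y, HasDerivAt
      (fun y => Q * (ε⁻¹ * Real.exp (-(α * y / ε))) + (G + 1) / α)
      (Q * (ε⁻¹ * (Real.exp (-(α * y / ε)) * (-(α / ε))))) y := by
    intro y
    have h1 : HasDerivAt (fun y => -(α * y / ε)) (-(α / ε)) y := by
      simpa using (((hasDerivAt_id y).const_mul α).div_const ε).fun_neg
    exact ((h1.exp.const_mul ε⁻¹).const_mul Q).add_const _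
  have key : ∀ p p' : ℝ → ℝ, (∀ y, HasDerivAt p (p' y) y) → p 0 ≤ Q * ε⁻¹ →
      (∀ y ∈ Icc (0:ℝ) 1, ε * p' y + a y * p y ≤ G) → ∀ y ∈ Icc (0:ℝ) 1,
      p y ≤ Q * (ε⁻¹ * Real.exp (-(α * y / ε))) + (G + 1) / α := by
    intro p p' hp hp0 hpe
    refine image_le_of_deriv_right_lt_deriv_boundary (f' := p')
      (fun y _ => (hp y).continuousAt.continuousWithinAt)
      (fun y _ => (hp y).hasDerivWithinAt) ?_ hB ?_
    · simp only [mul_zero, zero_div, neg_zero, Real.exp_zero, mul_one]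
      have : 0 ≤ (G + 1) / α := by positivity
      linarith
    · intro y hy hyB
      have hy' := Ico_subset_Icc_self hy
      have h1 := hpe y hy'
      rw [hyB] at h1
      set E := Real.exp (-(α * y / ε))
      have hE : 0 ≤ Q * (ε⁻¹ * E) := by positivity
      have h2 : α * (Q * (ε⁻¹ * E)) ≤ a y * (Q * (ε⁻¹ * E)) :=
        mul_le_mul_of_nonneg_right (ha y hy') hE
      have h3 : α * ((G + 1) / α) ≤ a y * ((G + 1) / α) :=
        mul_le_mul_of_nonneg_right (ha y hy') (by positivity)
      rw [mul_div_cancel₀ _ hα.ne'] at h3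
      have h4 : ε * (Q * (ε⁻¹ * (E * (-(α / ε))))) = -(α * (Q * (ε⁻¹ * E))) := by
        field_simp
      refine lt_of_mul_lt_mul_left ?_ hε.le
      rw [h4]
      linarith
  intro x hx
  rw [abs_le']
  refine ⟨key _ _ (fun y => (hu' y).hasDerivAt) ((le_abs_self _).trans hp0')
    (fun y hy => (heq y hy).le.trans ((le_abs_self _).trans (hG y hy))) x hx,
    key (fun y => -deriv u y) (fun y => -deriv (deriv u) y) (fun y => (hu' y).hasDerivAt.neg)
      ((neg_le_abs _).trans hp0')
      (fun y hy => ?_) x hx⟩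
  have := heq y hy
  linarith [neg_abs_le (g y), hG y hy]

/-- Relative change of consecutive mesh widths. -/
noncomputable def jumpRatio (x : ℕ → ℝ) (k : ℕ) : ℝ :=
  |(x (k + 2) - x (k + 1)) - (x (k + 1) - x k)| / (x (k + 2) - x (k + 1))

/-- Meshes on `[0, 1]` whose widths never drop by more than a factor two and whose relative width
changes have bounded sum. -/
structure IsLayerMesh (N : ℕ) (x : ℕ → ℝ) : Prop where
  zero : x 0 = 0
  last : x N = 1
  lt : ∀ k, k < N → x k < x (k + 1)
  le_two_mul : ∀ k, k + 1 < N → x (k + 1) - x k ≤ 2 * (x (k + 2) - x (k + 1))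
  ratio : ∀ n, n < N → ∑ k ∈ Finset.range n, jumpRatio x k ≤ 2

namespace IsLayerMesh

variable {N : ℕ} {x : ℕ → ℝ}

lemma le_of_le (hm : IsLayerMesh N x) {i j : ℕ} (hij : i ≤ j) (hj : j ≤ N) : x i ≤ x j := by
  induction j, hij using Nat.le_induction with
  | base => exact le_rfl
  | succ j hij ih => exact (ih (by omega)).trans (hm.lt j (by omega)).le

lemma mem_Icc (hm : IsLayerMesh N x) {j : ℕ} (hj : j ≤ N) : x j ∈ Icc (0:ℝ) 1 :=
  ⟨hm.zero ▸ hm.le_of_le (Nat.zero_le j) hj, hm.last ▸ hm.le_of_le hj le_rfl⟩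

lemma jumpRatio_nonneg (hm : IsLayerMesh N x) {k : ℕ} (hk : k + 1 < N) : 0 ≤ jumpRatio x k :=
  div_nonneg (abs_nonneg _) (sub_nonneg.2 (hm.lt (k + 1) hk).le)

lemma sum_succ_ratio (hm : IsLayerMesh N x) {n : ℕ} (hn : n + 1 < N) :
    ∑ k ∈ Finset.range n, jumpRatio x (k + 1) ≤ 2 := by
  have h := hm.ratio (n + 1) hn
  rw [Finset.sum_range_succ'] at h
  linarith [hm.jumpRatio_nonneg (k := 0) (by omega)]

lemma sum_succ_width (hm : IsLayerMesh N x) {n : ℕ} (hn : n < N) :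
    ∑ k ∈ Finset.range n, (x (k + 2) - x (k + 1)) ≤ 1 := by
  rw [Finset.sum_range_sub (fun k => x (k + 1))]
  linarith [(hm.mem_Icc (j := n + 1) hn).2, (hm.mem_Icc (j := 0 + 1) (by omega)).1]

end IsLayerMesh

lemma width_ratio_bounds {p q : ℝ} (hp : 0 < p) (hq : 0 < q) (hpq : p ≤ 2 * q) :
    -(|q - p| / q) ≤ q / ((p + q) / 2) - 1 ∧ q / ((p + q) / 2) - 1 ≤ |q - p| / q ∧
      |q - p| / q ≤ 1 := by
  have e : q / ((p + q) / 2) - 1 = (q - p) / (p + q) := by field_simp; ring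
  have h : |(q - p) / (p + q)| ≤ |q - p| / q := by
    rw [abs_div, abs_of_pos (by linarith : 0 < p + q)]
    exact div_le_div_of_nonneg_left (abs_nonneg _) hq (by linarith)
  rw [e]
  refine ⟨(abs_le.1 h).1, (abs_le.1 h).2, ?_⟩
  rw [div_le_one hq, abs_le]
  constructor <;> linarith

/-- Solution of the scalar first-order-plus-diffusion difference equation, bounded by the partial
sums of the data (discrete negative-norm stability). -/
lemma exists_scalar_solution {N : ℕ} {x : ℕ → ℝ} (hm : IsLayerMesh N x) {α A' ε M : ℝ}
    {a P : ℕ → ℝ} (hα : 0 < α) (hε : 0 < ε) (hA' : 0 ≤ A') (ha : ∀ j, j ≤ N → α ≤ a j)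
    (ha' : ∀ j, j < N → |a (j + 1) - a j| ≤ A' * (x (j + 1) - x j))
    (hP : ∀ j, j < N → |∑ k ∈ Finset.range j, P (k + 1)| ≤ M) (hM : 0 ≤ M) :
    ∃ z : ℕ → ℝ, (∀ j, j ≤ N → |z j| ≤ (6 / α + 2 * A' / α ^ 2) * M) ∧
      ∀ j, j + 1 < N → ε * (Dp x z (j + 1) - Dm x z (j + 1))
        + (x (j + 2) - x j) / 2 * (a (j + 1) * Dp x z (j + 1)) = P (j + 1) := by
  set S : ℕ → ℝ := fun j => ∑ k ∈ Finset.range j, P (k + 1) with hS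
  set ρ : ℕ → ℝ := fun j => (x (j + 2) - x j) / 2 * a (j + 1) / ε with hρ
  have hh : ∀ j, j < N → 0 < x (j + 1) - x j := fun j hj => sub_pos.2 (hm.lt j hj)
  have hbar : ∀ j, j + 1 < N → 0 < (x (j + 2) - x j) / 2 := fun j hj => by
    linarith [hh j (by omega), hh (j + 1) hj]
  have hapos : ∀ j, j ≤ N → 0 < a j := fun j hj => hα.trans_le (ha j hj)
  have hρ0 : ∀ j, j + 1 < N → 0 < ρ j := fun j hj =>
    div_pos (mul_pos (hbar j hj) (hapos _ (by omega))) hε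
  let Z : ℕ → ℝ := fun j => Nat.rec 0 (fun i r => (r + ρ i * S (i + 1)) / (1 + ρ i)) j
  have hZ0 : Z 0 = 0 := rfl
  have hZs : ∀ j, Z (j + 1) = (Z j + ρ j * S (j + 1)) / (1 + ρ j) := fun j => rfl
  have hZrel : ∀ j, j + 1 < N → Z (j + 1) - Z j = ρ j * (S (j + 1) - Z (j + 1)) := by
    intro j hj
    have h1 : (1 + ρ j) ≠ 0 := by linarith [hρ0 j hj]
    have h2 := hZs j
    rw [eq_div_iff h1] at h2
    linarith
  have hZM : ∀ j, j < N → |Z j| ≤ M := by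
    intro j
    induction j with
    | zero => intro _; simpa [hZ0] using hM
    | succ j ih =>
      intro hj
      have h0 := hρ0 j hj
      rw [hZs, abs_div, abs_of_pos (show 0 < 1 + ρ j by linarith), div_le_iff₀ (by linarith)]
      refine (abs_add_le _ _).trans ?_
      rw [abs_mul, abs_of_pos h0]
      have := mul_le_mul_of_nonneg_left (hP (j + 1) hj) h0.le
      have := ih (by omega)
      simp only [hS]
      linarith
  set z : ℕ → ℝ := fun j => ∑ k ∈ Finset.range j, (x (k + 1) - x k) * ((S k - Z k) / ε) with hz
  have hzs : ∀ j, z (j + 1) = z j + (x (j + 1) - x j) * ((S j - Z j) / ε) := fun j =>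
    Finset.sum_range_succ _ _
  have hD : ∀ j, j < N → Dp x z j = (S j - Z j) / ε := by
    intro j hj
    rw [Dp, hzs, add_sub_cancel_left, mul_div_cancel_left₀ _ (hh j hj).ne']
  have hDm : ∀ j, Dm x z (j + 1) = Dp x z j := fun j => by simp [Dm, Dp]
  refine ⟨z, ?_, ?_⟩
  · set c : ℕ → ℝ := fun j => (x (j + 2) - x (j + 1)) / ((x (j + 2) - x j) / 2) / a (j + 1) with hc
    have hκ : ∀ j, j + 1 < N →
        -jumpRatio x j ≤ (x (j + 2) - x (j + 1)) / ((x (j + 2) - x j) / 2) - 1 ∧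
        (x (j + 2) - x (j + 1)) / ((x (j + 2) - x j) / 2) - 1 ≤ jumpRatio x j ∧
        jumpRatio x j ≤ 1 := by
      intro j hj
      have := width_ratio_bounds (hh j (by omega)) (hh (j + 1) hj) (hm.le_two_mul j hj)
      rwa [show x (j + 1) - x j + (x (j + 2) - x (j + 1)) = x (j + 2) - x j by ring] at this
    have hzc : ∀ j, j + 1 < N → z (j + 2) = z (j + 1) + c j * (Z (j + 1) - Z j) := by
      intro j hj
      rw [hzs (j + 1), hZrel j hj]
      have h1 := (hbar j hj).ne'
      have h2 := (hapos (j + 1) (by omega)).ne'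
      have h3 : x (j + 2) - x j ≠ 0 := fun h => h1 (by rw [h]; simp)
      simp only [hc, hρ]
      field_simp
    have hcle : ∀ j, j + 1 < N → |c j| ≤ 2 / α := by
      intro j hj
      have h1 := hκ j hj
      have h2 := ha (j + 1) (by omega)
      rw [abs_of_nonneg (div_nonneg (by linarith) (by linarith))]
      exact div_le_div₀ (by norm_num) (by linarith) hα h2
    have hcv : ∀ j, j + 2 < N → |c j - c (j + 1)| ≤
        (jumpRatio x (j + 1) + jumpRatio x j) / α
          + 2 * A' / α ^ 2 * (x (j + 2) - x (j + 1)) := by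
      intro j hj
      have h1 := hκ j (by omega)
      have h2 := hκ (j + 1) hj
      set κ := (x (j + 2) - x (j + 1)) / ((x (j + 2) - x j) / 2)
      set κ' := (x (j + 1 + 2) - x (j + 1 + 1)) / ((x (j + 1 + 2) - x (j + 1)) / 2)
      have ha1 := ha (j + 1) (by omega)
      have ha2 := ha (j + 2) (by omega)
      have hp1 := hapos (j + 1) (by omega)
      have hp2 := hapos (j + 2) (by omega)
      have e : c j - c (j + 1) = (κ - κ') / a (j + 2)
          + κ * ((a (j + 2) - a (j + 1)) / (a (j + 1) * a (j + 2))) := by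
        change κ / a (j + 1) - κ' / a (j + 2) = _
        field_simp
        ring
      rw [e]
      refine (abs_add_le _ _).trans (add_le_add ?_ ?_)
      · rw [abs_div, abs_of_pos hp2]
        refine div_le_div₀ (by linarith) ?_ hα ha2
        rw [abs_le]; constructor <;> linarith
      · rw [abs_mul κ, abs_of_nonneg (by linarith : 0 ≤ κ), abs_div, abs_of_pos (mul_pos hp1 hp2)]
        have h3 : α ^ 2 ≤ a (j + 1) * a (j + 2) := by
          rw [sq]; exact mul_le_mul ha1 ha2 hα.le hp1.le
        have h4 : |a (j + 2) - a (j + 1)| / (a (j + 1) * a (j + 2))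
            ≤ A' * (x (j + 2) - x (j + 1)) / α ^ 2 :=
          div_le_div₀ (mul_nonneg hA' (hh (j + 1) (by omega)).le) (ha' (j + 1) (by omega))
            (by positivity) h3
        calc κ * (|a (j + 2) - a (j + 1)| / (a (j + 1) * a (j + 2)))
            ≤ 2 * (A' * (x (j + 2) - x (j + 1)) / α ^ 2) :=
              mul_le_mul (by linarith) h4 (by positivity) (by norm_num)
          _ = _ := by ring
    have hind : ∀ j, j + 1 < N → |z (j + 2) - c j * Z (j + 1)| ≤
        (∑ k ∈ Finset.range j, |c k - c (k + 1)|) * M := by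
      intro j
      induction j with
      | zero =>
        intro hj
        have h1 : z 1 = 0 := by simp [hz, hS, hZ0]
        have := hzc 0 hj
        rw [hZ0] at this
        simp only [zero_add] at this h1 ⊢
        rw [this, h1]
        simp
      | succ j ih =>
        intro hj
        rw [Finset.sum_range_succ, add_mul]
        have e : z (j + 1 + 2) - c (j + 1) * Z (j + 1 + 1)
            = (z (j + 2) - c j * Z (j + 1)) + (c j - c (j + 1)) * Z (j + 1) := by
          rw [hzc (j + 1) hj]; ring
        rw [e]
        refine (abs_add_le _ _).trans (add_le_add (ih (by omega)) ?_)
        rw [abs_mul]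
        exact mul_le_mul_of_nonneg_left (hZM (j + 1) (by omega)) (abs_nonneg _)
    have hV : ∀ j, j + 1 < N →
        ∑ k ∈ Finset.range j, |c k - c (k + 1)| ≤ 4 / α + 2 * A' / α ^ 2 := by
      intro j hj
      refine (Finset.sum_le_sum fun k hk => hcv k (by
        have := Finset.mem_range.1 hk; omega)).trans ?_
      rw [Finset.sum_add_distrib, ← Finset.sum_div, ← Finset.mul_sum, Finset.sum_add_distrib]
      have h1 := hm.sum_succ_ratio hj
      have h2 := hm.ratio j (by omega)
      have h3 := hm.sum_succ_width (n := j) (by omega)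
      refine add_le_add (div_le_div_of_nonneg_right (by linarith) hα.le) ?_
      exact mul_le_of_le_one_right (by positivity) h3
    have hC0 : 0 ≤ (6 / α + 2 * A' / α ^ 2) * M := by positivity
    intro j hj
    match j, hj with
    | 0, _ => simpa [hz] using hC0
    | 1, _ => simpa [hz, hS, hZ0] using hC0
    | j + 2, hj =>
      have h1 := hind j hj
      have h2 := mul_le_mul_of_nonneg_right (hV j hj) hM
      have h3 : |c j * Z (j + 1)| ≤ 2 / α * M := by
        rw [abs_mul]
        exact mul_le_mul (hcle j hj) (hZM _ hj) (abs_nonneg _) (by positivity)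
      have h4 := abs_add_le (z (j + 2) - c j * Z (j + 1)) (c j * Z (j + 1))
      rw [sub_add_cancel] at h4
      have h5 : (6 / α + 2 * A' / α ^ 2) * M
          = (4 / α + 2 * A' / α ^ 2) * M + 2 / α * M := by ring
      linarith
  · intro j hj
    rw [hDm, hD (j + 1) hj, hD j (by omega)]
    have h1 := hZrel j hj
    have h2 : S (j + 1) = S j + P (j + 1) := Finset.sum_range_succ _ _
    have h3 : (x (j + 2) - x j) / 2 * (a (j + 1) * ((S (j + 1) - Z (j + 1)) / ε))
        = ρ j * (S (j + 1) - Z (j + 1)) := by simp only [hρ]; ring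
    rw [h3, ← h1, ← sub_div, mul_div_cancel₀ _ hε.ne', h2]
    ring

lemma LN1_sub (ε : ℝ) (a b c : ℝ → ℝ) (x U V U' V' : ℕ → ℝ) (j : ℕ) :
    LN1 ε a b c x (fun i => U i - U' i) (fun i => V i - V' i) j
      = LN1 ε a b c x U V j - LN1 ε a b c x U' V' j := by
  simp only [LN1, delta2, Dp, Dm]
  ring

lemma mul_le_of_discrete_max {N : ℕ} {x : ℕ → ℝ} (hm : IsLayerMesh N x) {ε β M : ℝ}
    {a b c : ℝ → ℝ} {e e' : ℕ → ℝ} {j : ℕ} (hj : j + 1 < N) (hε : 0 < ε)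
    (ha : 0 ≤ a (x (j + 1))) (hb : β ≤ b (x (j + 1)) - c (x (j + 1))) (hc : 0 < c (x (j + 1)))
    (hmax : ∀ i ≤ N, e i ≤ e (j + 1)) (he' : e' (j + 1) ≤ e (j + 1)) (h0 : 0 ≤ e (j + 1))
    (hM : |LN1 ε a b c x e e' (j + 1)| ≤ M) : β * e (j + 1) ≤ M := by
  have h1 := hm.lt j (by omega)
  have h2 := hm.lt (j + 1) hj
  have hDp : Dp x e (j + 1) ≤ 0 :=
    div_nonpos_of_nonpos_of_nonneg (by linarith [hmax (j + 2) hj]) (by linarith)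
  have hDm : 0 ≤ Dm x e (j + 1) := by
    simp only [Dm, Nat.add_sub_cancel]
    exact div_nonneg (by linarith [hmax j (by omega)]) (by linarith)
  have hδ : delta2 x e (j + 1) ≤ 0 := by
    simp only [delta2, Nat.add_sub_cancel]
    exact div_nonpos_of_nonpos_of_nonneg (by linarith) (by linarith)
  have h3 := (abs_le.1 hM).1
  have h4 := mul_nonneg hε.le (neg_nonneg.2 hδ)
  have h5 := mul_nonneg ha (neg_nonneg.2 hDp)
  have h6 := mul_le_mul_of_nonneg_left he' hc.le
  have h7 := mul_le_mul_of_nonneg_right hb h0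
  simp only [LN1] at h3
  linarith

lemma mul_abs_le_of_discrete_max {N : ℕ} {x : ℕ → ℝ} (hm : IsLayerMesh N x) {ε β M : ℝ}
    {a b c : ℝ → ℝ} {e e' : ℕ → ℝ} {j : ℕ} (hj : j + 1 < N) (hε : 0 < ε)
    (ha : 0 ≤ a (x (j + 1))) (hb : β ≤ b (x (j + 1)) - c (x (j + 1))) (hc : 0 < c (x (j + 1)))
    (hmax : ∀ i ≤ N, |e i| ≤ |e (j + 1)|) (he' : |e' (j + 1)| ≤ |e (j + 1)|)
    (hM : |LN1 ε a b c x e e' (j + 1)| ≤ M) : β * |e (j + 1)| ≤ M := by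
  rcases le_total 0 (e (j + 1)) with h0 | h0
  · rw [abs_of_nonneg h0] at hmax he' ⊢
    exact mul_le_of_discrete_max hm hj hε ha hb hc (fun i hi => (le_abs_self _).trans (hmax i hi))
      ((le_abs_self _).trans he') h0 hM
  · rw [abs_of_nonpos h0] at hmax he' ⊢
    refine mul_le_of_discrete_max (e := fun i => -e i) (e' := fun i => -e' i) hm hj hε ha hb hc
      (fun i hi => (neg_le_abs _).trans (hmax i hi))
      ((neg_le_abs _).trans he') (by simpa using h0) ?_
    have e1 : LN1 ε a b c x (fun i => -e i) (fun i => -e' i) (j + 1)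
        = -LN1 ε a b c x e e' (j + 1) := by
      simp only [LN1, delta2, Dp, Dm]; ring
    rwa [e1, abs_neg]

/-- Maximum-norm stability of the discrete system. -/
lemma abs_le_of_discrete_system {N : ℕ} {x : ℕ → ℝ} (hm : IsLayerMesh N x) {β ε₁ ε₂ M K : ℝ}
    {a₁ a₂ b₁₁ b₁₂ b₂₁ b₂₂ : ℝ → ℝ} {e₁ e₂ : ℕ → ℝ} (hβ : 0 < β) (hε₁ : 0 < ε₁) (hε₂ : 0 < ε₂)
    (ha₁ : ∀ x ∈ Icc (0:ℝ) 1, 0 ≤ a₁ x) (ha₂ : ∀ x ∈ Icc (0:ℝ) 1, 0 ≤ a₂ x)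
    (hb₁ : ∀ x ∈ Icc (0:ℝ) 1, β ≤ b₁₁ x - b₁₂ x)
    (hb₂ : ∀ x ∈ Icc (0:ℝ) 1, β ≤ b₂₂ x - b₂₁ x)
    (hb₁₂ : ∀ x ∈ Icc (0:ℝ) 1, 0 < b₁₂ x) (hb₂₁ : ∀ x ∈ Icc (0:ℝ) 1, 0 < b₂₁ x)
    (h₁ : ∀ j, j + 1 < N → |LN1 ε₁ a₁ b₁₁ b₁₂ x e₁ e₂ (j + 1)| ≤ M)
    (h₂ : ∀ j, j + 1 < N → |LN1 ε₂ a₂ b₂₂ b₂₁ x e₂ e₁ (j + 1)| ≤ M)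
    (h₁0 : |e₁ 0| ≤ K) (h₂0 : |e₂ 0| ≤ K) (h₁N : |e₁ N| ≤ K) (h₂N : |e₂ N| ≤ K)
    (hK : M / β ≤ K) : ∀ j ≤ N, |e₁ j| ≤ K ∧ |e₂ j| ≤ K := by
  obtain ⟨i, hi, hmax⟩ := Finset.exists_max_image (Finset.range (N + 1))
    (fun j => max |e₁ j| |e₂ j|) ⟨0, by simp⟩
  have hmax' : ∀ j ≤ N, max |e₁ j| |e₂ j| ≤ max |e₁ i| |e₂ i| := fun j hj =>
    hmax j (Finset.mem_range.2 (by omega))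
  have hiN : i ≤ N := by have := Finset.mem_range.1 hi; omega
  have hle : max |e₁ i| |e₂ i| ≤ K := by
    rw [div_le_iff₀' hβ] at hK
    by_cases h0 : i = 0
    · subst h0; exact max_le h₁0 h₂0
    by_cases hN : i = N
    · subst hN; exact max_le h₁N h₂N
    obtain ⟨j, rfl⟩ := Nat.exists_eq_succ_of_ne_zero h0
    have hj : j + 1 < N := by omega
    have hx := hm.mem_Icc hiN
    rcases le_total |e₂ (j + 1)| |e₁ (j + 1)| with h | h
    · simp only [Nat.succ_eq_add_one, max_eq_left h] at hmax' ⊢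
      refine le_of_mul_le_mul_left (le_trans ?_ hK) hβ
      exact mul_abs_le_of_discrete_max hm hj hε₁ (ha₁ _ hx) (hb₁ _ hx) (hb₁₂ _ hx)
        (fun k hk => (le_max_left _ _).trans (hmax' k hk)) h (h₁ j hj)
    · simp only [Nat.succ_eq_add_one, max_eq_right h] at hmax' ⊢
      refine le_of_mul_le_mul_left (le_trans ?_ hK) hβ
      exact mul_abs_le_of_discrete_max hm hj hε₂ (ha₂ _ hx) (hb₂ _ hx) (hb₂₁ _ hx)
        (fun k hk => (le_max_right _ _).trans (hmax' k hk)) h (h₂ j hj)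
  intro j hj
  exact max_le_iff.1 ((hmax' j hj).trans hle)

/-- Negative-norm stability of the discrete system: the error is controlled by the partial sums of
the weighted truncation error. -/
lemma abs_error_le {N : ℕ} {x : ℕ → ℝ} (hm : IsLayerMesh N x) {α β ε₁ ε₂ A' B M : ℝ}
    {a₁ a₂ b₁₁ b₁₂ b₂₁ b₂₂ : ℝ → ℝ} {e₁ e₂ : ℕ → ℝ} (hα : 0 < α) (hβ : 0 < β)
    (hε₁ : 0 < ε₁) (hε₂ : 0 < ε₂) (hM : 0 ≤ M)
    (hd₁ : Differentiable ℝ a₁) (hd₂ : Differentiable ℝ a₂)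
    (ha₁ : ∀ x ∈ Icc (0:ℝ) 1, α ≤ a₁ x) (ha₂ : ∀ x ∈ Icc (0:ℝ) 1, α ≤ a₂ x)
    (ha₁' : ∀ x ∈ Icc (0:ℝ) 1, |deriv a₁ x| ≤ A') (ha₂' : ∀ x ∈ Icc (0:ℝ) 1, |deriv a₂ x| ≤ A')
    (hb₁ : ∀ x ∈ Icc (0:ℝ) 1, β ≤ b₁₁ x - b₁₂ x)
    (hb₂ : ∀ x ∈ Icc (0:ℝ) 1, β ≤ b₂₂ x - b₂₁ x)
    (hb₁₂ : ∀ x ∈ Icc (0:ℝ) 1, 0 < b₁₂ x) (hb₂₁ : ∀ x ∈ Icc (0:ℝ) 1, 0 < b₂₁ x)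
    (hB₁ : ∀ x ∈ Icc (0:ℝ) 1, |b₁₁ x| ≤ B ∧ |b₁₂ x| ≤ B)
    (hB₂ : ∀ x ∈ Icc (0:ℝ) 1, |b₂₂ x| ≤ B ∧ |b₂₁ x| ≤ B)
    (h₁0 : e₁ 0 = 0) (h₂0 : e₂ 0 = 0) (h₁N : e₁ N = 0) (h₂N : e₂ N = 0)
    (h₁ : ∀ j, j < N → |∑ k ∈ Finset.range j,
      (x (k + 2) - x k) / 2 * LN1 ε₁ a₁ b₁₁ b₁₂ x e₁ e₂ (k + 1)| ≤ M)
    (h₂ : ∀ j, j < N → |∑ k ∈ Finset.range j,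
      (x (k + 2) - x k) / 2 * LN1 ε₂ a₂ b₂₂ b₂₁ x e₂ e₁ (k + 1)| ≤ M) :
    ∀ j ≤ N, |e₁ j| ≤ (6 / α + 2 * A' / α ^ 2) * M * (2 + 2 * B / β) ∧
      |e₂ j| ≤ (6 / α + 2 * A' / α ^ 2) * M * (2 + 2 * B / β) := by
  have m0 : (0:ℝ) ∈ Icc (0:ℝ) 1 := by simp
  have hA' : 0 ≤ A' := (abs_nonneg _).trans (ha₁' 0 m0)
  have hB : 0 ≤ B := (abs_nonneg _).trans (hB₁ 0 m0).1
  have hlip : ∀ a : ℝ → ℝ, Differentiable ℝ a → (∀ x ∈ Icc (0:ℝ) 1, |deriv a x| ≤ A') →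
      ∀ j, j < N → |a (x (j + 1)) - a (x j)| ≤ A' * (x (j + 1) - x j) := by
    intro a hd ha j hj
    have := abs_sub_le_of_abs_deriv_le (hm.lt j hj).le (φ := a) (φ' := deriv a)
      (B := fun y => A' * y) (B' := fun _ => A') (fun y _ => (hd y).hasDerivAt)
      (fun y _ => by simpa using (hasDerivAt_id y).const_mul A')
      (fun y hy => ha y ⟨(hm.mem_Icc hj.le).1.trans hy.1, hy.2.trans (hm.mem_Icc hj).2⟩)
    linarith
  set K := (6 / α + 2 * A' / α ^ 2) * M with hK
  have hK0 : 0 ≤ K := by positivity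
  obtain ⟨P₁, hP₁⟩ : ∃ P : ℕ → ℝ, ∀ k, P (k + 1)
      = (x (k + 2) - x k) / 2 * LN1 ε₁ a₁ b₁₁ b₁₂ x e₁ e₂ (k + 1) :=
    ⟨fun k => (x (k + 1) - x (k - 1)) / 2 * LN1 ε₁ a₁ b₁₁ b₁₂ x e₁ e₂ k, fun k => rfl⟩
  obtain ⟨P₂, hP₂⟩ : ∃ P : ℕ → ℝ, ∀ k, P (k + 1)
      = (x (k + 2) - x k) / 2 * LN1 ε₂ a₂ b₂₂ b₂₁ x e₂ e₁ (k + 1) :=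
    ⟨fun k => (x (k + 1) - x (k - 1)) / 2 * LN1 ε₂ a₂ b₂₂ b₂₁ x e₂ e₁ k, fun k => rfl⟩
  simp only [← hP₁] at h₁
  simp only [← hP₂] at h₂
  obtain ⟨z₁, hz₁, hz₁'⟩ := exists_scalar_solution hm (a := fun j => a₁ (x j)) hα hε₁ hA'
    (fun j hj => ha₁ _ (hm.mem_Icc hj)) (hlip a₁ hd₁ ha₁') h₁ hM
  obtain ⟨z₂, hz₂, hz₂'⟩ := exists_scalar_solution hm (a := fun j => a₂ (x j)) hα hε₂ hA'
    (fun j hj => ha₂ _ (hm.mem_Icc hj)) (hlip a₂ hd₂ ha₂') h₂ hM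
  have key : ∀ (ε : ℝ) (a b c : ℝ → ℝ) (e e' z z' P : ℕ → ℝ),
      (∀ y ∈ Icc (0:ℝ) 1, |b y| ≤ B ∧ |c y| ≤ B) →
      (∀ j ≤ N, |z j| ≤ K) → (∀ j ≤ N, |z' j| ≤ K) →
      (∀ k, P (k + 1) = (x (k + 2) - x k) / 2 * LN1 ε a b c x e e' (k + 1)) →
      (∀ j, j + 1 < N → ε * (Dp x z (j + 1) - Dm x z (j + 1))
        + (x (j + 2) - x j) / 2 * (a (x (j + 1)) * Dp x z (j + 1)) = P (j + 1)) →
      ∀ j, j + 1 < N →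
        |LN1 ε a b c x (fun i => e i - z i) (fun i => e' i - z' i) (j + 1)| ≤ 2 * B * K := by
    intro ε a b c e e' z z' P hbc hz hz' hP hPz j hj
    have hbar : 0 < (x (j + 2) - x j) / 2 := by
      linarith [hm.lt j (by omega), hm.lt (j + 1) hj]
    have h3 := hPz j hj
    rw [hP] at h3
    have hzj := hz (j + 1) (by omega)
    have hzj' := hz' (j + 1) (by omega)
    obtain ⟨hbj, hcj⟩ := hbc _ (hm.mem_Icc (j := j + 1) (by omega))
    have e1 : LN1 ε a b c x z z' (j + 1) = LN1 ε a b c x e e' (j + 1)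
        - b (x (j + 1)) * z (j + 1) + c (x (j + 1)) * z' (j + 1) := by
      have h4 : delta2 x z (j + 1) * ((x (j + 2) - x j) / 2)
          = Dp x z (j + 1) - Dm x z (j + 1) := by
        simp only [delta2, Nat.add_sub_cancel]
        exact div_mul_cancel₀ _ hbar.ne'
      rw [← h4] at h3
      have h5 : ε * delta2 x z (j + 1) + a (x (j + 1)) * Dp x z (j + 1)
          = LN1 ε a b c x e e' (j + 1) := by
        refine mul_left_cancel₀ hbar.ne' ?_
        linarith
      rw [← h5, LN1]
    rw [LN1_sub, e1]
    have e2 : LN1 ε a b c x e e' (j + 1) - (LN1 ε a b c x e e' (j + 1)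
        - b (x (j + 1)) * z (j + 1) + c (x (j + 1)) * z' (j + 1))
        = b (x (j + 1)) * z (j + 1) - c (x (j + 1)) * z' (j + 1) := by ring
    rw [e2]
    refine (abs_sub _ _).trans ?_
    rw [abs_mul, abs_mul]
    have := mul_le_mul hbj hzj (abs_nonneg _) hB
    have := mul_le_mul hcj hzj' (abs_nonneg _) hB
    linarith
  have hK' : K ≤ K * (1 + 2 * B / β) := by
    have : 0 ≤ 2 * B / β := by positivity
    nlinarith
  have hst := abs_le_of_discrete_system hm (K := K * (1 + 2 * B / β)) hβ hε₁ hε₂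
    (fun y hy => hα.le.trans (ha₁ y hy)) (fun y hy => hα.le.trans (ha₂ y hy)) hb₁ hb₂ hb₁₂ hb₂₁
    (key ε₁ a₁ b₁₁ b₁₂ e₁ e₂ z₁ z₂ P₁ hB₁ hz₁ hz₂ hP₁ hz₁')
    (key ε₂ a₂ b₂₂ b₂₁ e₂ e₁ z₂ z₁ P₂ hB₂ hz₂ hz₁ hP₂ hz₂')
    (by simpa [h₁0] using (hz₁ 0 (by omega)).trans hK')
    (by simpa [h₂0] using (hz₂ 0 (by omega)).trans hK')
    (by simpa [h₁N] using (hz₁ N le_rfl).trans hK')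
    (by simpa [h₂N] using (hz₂ N le_rfl).trans hK')
    (by rw [mul_add, mul_one, div_eq_mul_inv, div_eq_mul_inv]; linarith)
  intro j hj
  have e3 : K * (2 + 2 * B / β) = K * (1 + 2 * B / β) + K := by ring
  rw [e3]
  constructor
  · have := abs_add_le (e₁ j - z₁ j) (z₁ j)
    rw [sub_add_cancel] at this
    linarith [(hst j hj).1, hz₁ j hj]
  · have := abs_add_le (e₂ j - z₂ j) (z₂ j)
    rw [sub_add_cancel] at this
    linarith [(hst j hj).2, hz₂ j hj]

/-- Local flux balance: the diffusive flux difference matches frozen-coefficient data. -/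
lemma abs_flux_balance_le {ε η A' s t y : ℝ} {a g u m m' : ℝ → ℝ} (hs : 0 ≤ s) (ht : t ≤ 1)
    (hu : Differentiable ℝ u) (hu' : Differentiable ℝ (deriv u))
    (ha : Differentiable ℝ a) (hg : Differentiable ℝ g)
    (hA' : ∀ x ∈ Icc (0:ℝ) 1, |deriv a x| ≤ A')
    (hm : ∀ x, HasDerivAt m (m' x) x)
    (hum : ∀ x ∈ Icc (0:ℝ) 1, |deriv u x| ≤ m' x) (hgm : ∀ x ∈ Icc (0:ℝ) 1, |deriv g x| ≤ m' x)
    (heq : ∀ x ∈ Icc (0:ℝ) 1, ε * deriv (deriv u) x + a x * deriv u x = g x)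
    (hη : m t - m s ≤ η) (hy : y ∈ Icc s t) :
    |ε * deriv u y - ε * deriv u s - (y - s) * g s + a s * (u y - u s)|
      ≤ (1 + A') * η * (t - s) := by
  have hsub : ∀ {r}, r ∈ Icc s t → r ∈ Icc (0:ℝ) 1 := fun hr =>
    ⟨hs.trans hr.1, hr.2.trans ht⟩
  have hst : s ≤ t := hy.1.trans hy.2
  have hA'0 : 0 ≤ A' := (abs_nonneg _).trans (hA' s (hsub ⟨le_rfl, hst⟩))
  have hgle : ∀ {p q}, p ∈ Icc s t → q ∈ Icc s t → p ≤ q → |g q - g p| ≤ m q - m p := by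
    intro p q hp hq hpq
    exact abs_sub_le_of_abs_deriv_le hpq (fun r _ => (hg r).hasDerivAt) (fun r _ => hm r)
      (fun r hr => hgm r (hsub ⟨hp.1.trans hr.1, hr.2.trans hq.2⟩))
  have hmle : ∀ {r}, r ∈ Icc s t → m r - m s ≤ η := by
    intro r hr
    have := (abs_nonneg _).trans (hgle hr ⟨hst, le_rfl⟩ hr.2)
    linarith
  have hale : ∀ {r}, r ∈ Icc s t → |a r - a s| ≤ A' * (t - s) := by
    intro r hr
    have := abs_sub_le_of_abs_deriv_le hr.1 (φ := a) (φ' := deriv a)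
      (B := fun v => A' * v) (B' := fun _ => A') (fun v _ => (ha v).hasDerivAt)
      (fun v _ => by simpa using (hasDerivAt_id v).const_mul A')
      (fun v hv => hA' v (hsub ⟨hv.1, hv.2.trans hr.2⟩))
    have h2 := mul_le_mul_of_nonneg_left hr.2 hA'0
    linarith
  have main := abs_sub_le_of_abs_deriv_le hy.1
    (φ := fun r => ε * deriv u r - r * g s + a s * u r)
    (φ' := fun r => ε * deriv (deriv u) r - g s + a s * deriv u r)
    (B := fun r => η * r + A' * (t - s) * m r) (B' := fun r => η + A' * (t - s) * m' r)
    (fun r _ => (((hu' r).hasDerivAt.const_mul ε).sub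
      (by simpa using (hasDerivAt_id r).mul_const (g s))).add ((hu r).hasDerivAt.const_mul (a s)))
    (fun r _ => HasDerivAt.add (by simpa using (hasDerivAt_id r).const_mul η)
      ((hm r).const_mul (A' * (t - s))))
    (fun r hr => by
      have hr' : r ∈ Icc s t := ⟨hr.1, hr.2.trans hy.2⟩
      have e : ε * deriv (deriv u) r - g s + a s * deriv u r
          = (g r - g s) - (a r - a s) * deriv u r := by linarith [heq r (hsub hr')]
      rw [e]
      refine (abs_sub _ _).trans (add_le_add ?_ ?_)
      · exact (hgle ⟨le_rfl, hst⟩ hr' hr.1).trans (hmle hr')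
      · rw [abs_mul]
        exact mul_le_mul (hale hr') (hum r (hsub hr')) (abs_nonneg _)
          (mul_nonneg hA'0 (sub_nonneg.2 hst)))
  have hη0 : 0 ≤ η := by
    have := hmle ⟨le_rfl, hst⟩
    linarith
  have e1 : ε * deriv u y - ε * deriv u s - (y - s) * g s + a s * (u y - u s)
      = ε * deriv u y - y * g s + a s * u y - (ε * deriv u s - s * g s + a s * u s) := by ring
  rw [e1]
  refine main.trans ?_
  have h1 := mul_le_mul_of_nonneg_left (hmle hy) (mul_nonneg hA'0 (sub_nonneg.2 hst))
  have h2 := mul_le_mul_of_nonneg_left hy.2 hη0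
  linarith

/-- Consistency: the partial sums of the weighted truncation error are bounded by the largest
increment of a majorant over one mesh interval. -/
lemma abs_sum_truncation_le {N : ℕ} {x : ℕ → ℝ} (hx : IsLayerMesh N x) {ε η A A' G : ℝ}
    {a g u m m' : ℝ → ℝ}
    (hu : Differentiable ℝ u) (hu' : Differentiable ℝ (deriv u))
    (ha : Differentiable ℝ a) (hg : Differentiable ℝ g)
    (hA : ∀ x ∈ Icc (0:ℝ) 1, |a x| ≤ A)
    (hA' : ∀ x ∈ Icc (0:ℝ) 1, |deriv a x| ≤ A') (hG : ∀ x ∈ Icc (0:ℝ) 1, |g x| ≤ G)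
    (hm : ∀ x, HasDerivAt m (m' x) x) (hm1 : ∀ x ∈ Icc (0:ℝ) 1, 1 ≤ m' x)
    (hum : ∀ x ∈ Icc (0:ℝ) 1, |deriv u x| ≤ m' x) (hgm : ∀ x ∈ Icc (0:ℝ) 1, |deriv g x| ≤ m' x)
    (heq : ∀ x ∈ Icc (0:ℝ) 1, ε * deriv (deriv u) x + a x * deriv u x = g x)
    (hη : ∀ k, k < N → m (x (k + 1)) - m (x k) ≤ η) (hη0 : 0 ≤ η) :
    ∀ j, j < N → |∑ k ∈ Finset.range j, (x (k + 2) - x k) / 2 *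
      (g (x (k + 1)) - ε * delta2 x (fun i => u (x i)) (k + 1)
        - a (x (k + 1)) * Dp x (fun i => u (x i)) (k + 1))| ≤ 6 * (1 + A' + G + A) * η := by
  have m0 : (0:ℝ) ∈ Icc (0:ℝ) 1 := by simp
  have hA0 : 0 ≤ A := (abs_nonneg _).trans (hA 0 m0)
  have hA'0 : 0 ≤ A' := (abs_nonneg _).trans (hA' 0 m0)
  have hG0 : 0 ≤ G := (abs_nonneg _).trans (hG 0 m0)
  set d : ℕ → ℝ := fun k => Dp x (fun i => u (x i)) k with hd
  set w : ℕ → ℝ := fun k => ε * deriv u (x k) with hw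
  have hh : ∀ k, k < N → 0 < x (k + 1) - x k := fun k hk => sub_pos.2 (hx.lt k hk)
  have hh1 : ∀ k, k < N → x (k + 1) - x k ≤ 1 := fun k hk => by
    linarith [(hx.mem_Icc (j := k + 1) hk).2, (hx.mem_Icc hk.le).1]
  have hsub : ∀ k, k < N → ∀ y ∈ Icc (x k) (x (k + 1)), y ∈ Icc (0:ℝ) 1 := fun k hk y hy =>
    ⟨(hx.mem_Icc hk.le).1.trans hy.1, hy.2.trans (hx.mem_Icc (j := k + 1) hk).2⟩
  have hinc : ∀ k, k < N → ∀ y ∈ Icc (x k) (x (k + 1)), |u y - u (x k)| ≤ η := by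
    intro k hk y hy
    have h1 := abs_sub_le_of_abs_deriv_le hy.1 (fun r _ => (hu r).hasDerivAt) (fun r _ => hm r)
      (fun r hr => hum r (hsub k hk r ⟨hr.1, hr.2.trans hy.2⟩))
    have h2 := abs_sub_le_of_abs_deriv_le hy.2 (fun r _ => (hu r).hasDerivAt) (fun r _ => hm r)
      (fun r hr => hum r (hsub k hk r ⟨hy.1.trans hr.1, hr.2⟩))
    linarith [hη k hk, abs_nonneg (u (x (k + 1)) - u y)]
  have hwη : ∀ k, k < N → x (k + 1) - x k ≤ η := by
    intro k hk
    have h1 := abs_sub_le_of_abs_deriv_le (hx.lt k hk).le (fun r _ => hasDerivAt_id r)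
      (fun r _ => hm r) (fun r hr => by simpa using hm1 r (hsub k hk r hr))
    simp only [id] at h1
    linarith [le_abs_self (x (k + 1) - x k), hη k hk]
  have hflux : ∀ k, k < N → ∀ y ∈ Icc (x k) (x (k + 1)),
      |ε * deriv u y - w k - (y - x k) * g (x k) + a (x k) * (u y - u (x k))|
        ≤ (1 + A') * η * (x (k + 1) - x k) := fun k hk y hy =>
    abs_flux_balance_le (hx.mem_Icc hk.le).1 (hx.mem_Icc (j := k + 1) hk).2 hu hu' ha hg hA' hm
      hum hgm heq (hη k hk) hy
  have hdu : ∀ k, k < N → (x (k + 1) - x k) * d k = u (x (k + 1)) - u (x k) := fun k hk =>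
    mul_div_cancel₀ _ (hh k hk).ne'
  have hnode : ∀ k, k < N → |ε * d k - w k| ≤ (1 + A' + G + A) * η ∧
      |ε * d k - w (k + 1)| ≤ 2 * (1 + A' + G + A) * η := by
    intro k hk
    obtain ⟨ξ, hξ, hmv⟩ := exists_deriv_eq_slope u (hx.lt k hk) hu.continuous.continuousOn
      hu.differentiableOn
    have hdk : d k = deriv u ξ := hmv.symm
    have hstep : ∀ y ∈ Icc (x k) (x (k + 1)), |ε * deriv u y - w k| ≤ (1 + A' + G + A) * η := by
      intro y hy
      have h1 := abs_le.1 (hflux k hk y hy)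
      have h2 : |(y - x k) * g (x k)| ≤ η * G := by
        rw [abs_mul, abs_of_nonneg (sub_nonneg.2 hy.1)]
        exact mul_le_mul ((sub_le_sub_right hy.2 _).trans (hwη k hk)) (hG _ (hx.mem_Icc hk.le))
          (abs_nonneg _) hη0
      have h3 : |a (x k) * (u y - u (x k))| ≤ A * η := by
        rw [abs_mul]
        exact mul_le_mul (hA _ (hx.mem_Icc hk.le)) (hinc k hk y hy) (abs_nonneg _) hA0
      have h4 : (1 + A') * η * (x (k + 1) - x k) ≤ (1 + A') * η :=
        mul_le_of_le_one_right (by positivity) (hh1 k hk)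
      have h5 := abs_le.1 h2
      have h6 := abs_le.1 h3
      rw [abs_le]
      constructor <;> linarith
    have h1 := hstep ξ (Ioo_subset_Icc_self hξ)
    have h2 := hstep (x (k + 1)) ⟨(hx.lt k hk).le, le_rfl⟩
    rw [hdk]
    refine ⟨h1, ?_⟩
    have h3 := abs_le.1 h1
    have h4 := abs_le.1 h2
    change -_ ≤ w (k + 1) - w k ∧ w (k + 1) - w k ≤ _ at h4
    rw [abs_le]
    constructor <;> linarith
  have hterm : ∀ k, k + 1 < N → (x (k + 2) - x k) / 2 *
      (g (x (k + 1)) - ε * delta2 x (fun i => u (x i)) (k + 1)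
        - a (x (k + 1)) * Dp x (fun i => u (x i)) (k + 1))
      = (x (k + 2) - x k) / 2 * (g (x (k + 1)) - a (x (k + 1)) * d (k + 1))
        - ε * (d (k + 1) - d k) := by
    intro k hk
    have hbar : 0 < (x (k + 2) - x k) / 2 := by
      linarith [hh k (by omega), hh (k + 1) hk]
    have h4 : delta2 x (fun i => u (x i)) (k + 1) * ((x (k + 2) - x k) / 2)
        = d (k + 1) - d k := by
      simp only [delta2, Dm, Nat.add_sub_cancel]
      exact div_mul_cancel₀ _ hbar.ne'
    rw [← h4]
    simp only [hd]
    ring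
  have hind : ∀ j, j < N → |(∑ k ∈ Finset.range j, (x (k + 2) - x k) / 2 *
      (g (x (k + 1)) - ε * delta2 x (fun i => u (x i)) (k + 1)
        - a (x (k + 1)) * Dp x (fun i => u (x i)) (k + 1)))
        + (ε * d j - w (j + 1)) - (ε * d 0 - w 1)|
      ≤ (1 + A') * η * ∑ k ∈ Finset.range j, (x (k + 2) - x (k + 1))
        + (G + A) * η / 2 * ∑ k ∈ Finset.range j, jumpRatio x k := by
    intro j
    induction j with
    | zero => intro _; simp
    | succ j ih =>
      intro hj
      have hih := abs_le.1 (ih (by omega))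
      simp only [Finset.sum_range_succ] at hih ⊢
      rw [hterm j hj]
      have h1 := hflux (j + 1) hj (x (j + 2)) ⟨(hx.lt (j + 1) hj).le, le_rfl⟩
      rw [← hdu (j + 1) hj] at h1
      change |w (j + 2) - w (j + 1) - (x (j + 2) - x (j + 1)) * g (x (j + 1))
        + a (x (j + 1)) * ((x (j + 2) - x (j + 1)) * d (j + 1))|
        ≤ (1 + A') * η * (x (j + 2) - x (j + 1)) at h1
      have h2 : |((x (j + 2) - x (j + 1)) - (x (j + 1) - x j)) / 2 *
          (g (x (j + 1)) - a (x (j + 1)) * d (j + 1))| ≤ (G + A) * η / 2 * jumpRatio x j := by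
        have h0 := hx.jumpRatio_nonneg hj
        have hmem := hx.mem_Icc (j := j + 1) hj.le
        have e : (x (j + 2) - x (j + 1)) * (g (x (j + 1)) - a (x (j + 1)) * d (j + 1))
            = (x (j + 2) - x (j + 1)) * g (x (j + 1))
              - a (x (j + 1)) * (u (x (j + 2)) - u (x (j + 1))) := by
          rw [← hdu (j + 1) hj]; ring
        have h3 : |(x (j + 2) - x (j + 1)) * (g (x (j + 1)) - a (x (j + 1)) * d (j + 1))|
            ≤ η * G + A * η := by
          rw [e]
          refine (abs_sub _ _).trans (add_le_add ?_ ?_)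
          · rw [abs_mul, abs_of_pos (hh (j + 1) hj)]
            exact mul_le_mul (hwη (j + 1) hj) (hG _ hmem) (abs_nonneg _) hη0
          · rw [abs_mul]
            exact mul_le_mul (hA _ hmem)
              (hinc (j + 1) hj _ ⟨(hx.lt (j + 1) hj).le, le_rfl⟩) (abs_nonneg _) hA0
        have h4 := mul_le_mul_of_nonneg_left h3 (by positivity : 0 ≤ jumpRatio x j / 2)
        rw [abs_mul, abs_of_pos (hh (j + 1) hj)] at h4
        have h5 : jumpRatio x j * (x (j + 2) - x (j + 1))
            = |(x (j + 2) - x (j + 1)) - (x (j + 1) - x j)| :=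
          div_mul_cancel₀ _ (hh (j + 1) hj).ne'
        rw [abs_mul, abs_div, ← h5, abs_of_pos (two_pos (α := ℝ))]
        linarith
      have h5 : (x (j + 2) - x j) / 2 = (x (j + 2) - x (j + 1))
          - ((x (j + 2) - x (j + 1)) - (x (j + 1) - x j)) / 2 := by ring
      rw [h5]
      have h1' := abs_le.1 h1
      have h2' := abs_le.1 h2
      change |_ + (ε * d (j + 1) - w (j + 2)) - (ε * d 0 - w 1)| ≤ _
      rw [abs_le]
      constructor <;> linarith
  intro j hj
  have h1 := abs_le.1 (hind j hj)
  have h2 := abs_le.1 (hnode j hj).2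
  have h3 := abs_le.1 (hnode 0 (by omega)).2
  have h4 : (1 + A') * η * ∑ k ∈ Finset.range j, (x (k + 2) - x (k + 1)) ≤ (1 + A') * η :=
    mul_le_of_le_one_right (by positivity) (hx.sum_succ_width hj)
  have h5 := mul_le_mul_of_nonneg_left (hx.ratio j hj) (by positivity : 0 ≤ (G + A) * η / 2)
  have h6 : 0 ≤ (G + A) * η := by positivity
  have h7 : 0 ≤ (1 + A') * η := by positivity
  change -_ ≤ ε * d 0 - w 1 ∧ ε * d 0 - w 1 ≤ _ at h3
  rw [abs_le]
  constructor <;> linarith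

lemma isLayerMesh_of_widths {n : ℕ} {x : ℕ → ℝ} {w₁ w₂ w₃ : ℝ} (hw₁ : 0 < w₁)
    (h₁₂ : w₁ ≤ w₂) (hw₃ : 0 < w₃)
    (h₂₃ : w₂ ≤ 2 * w₃) (h0 : x 0 = 0) (hlast : x (4 * n) = 1)
    (hw : ∀ j, j < 4 * n → x (j + 1) - x j = if j < n then w₁ else if j < 2 * n then w₂ else w₃) :
    IsLayerMesh (4 * n) x := by
  have hpos : ∀ j, j < 4 * n → 0 < x (j + 1) - x j := by
    intro j hj; rw [hw j hj]; split_ifs <;> linarith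
  have hdrop : ∀ k, k + 1 < 4 * n → x (k + 1) - x k ≤ 2 * (x (k + 2) - x (k + 1)) := by
    intro k hk
    rw [hw k (by omega), hw (k + 1) hk]
    split_ifs <;> first | omega | linarith
  refine ⟨h0, hlast, fun k hk => sub_pos.1 (hpos k hk), hdrop, ?_⟩
  intro m hm
  have hle : ∀ k ∈ Finset.range m, jumpRatio x k ≤
      (if k = n - 1 then (1:ℝ) else 0) + (if k = 2 * n - 1 then (1:ℝ) else 0) := by
    intro k hk
    have hk' : k + 1 < 4 * n := by have := Finset.mem_range.1 hk; omega
    have hle1 : jumpRatio x k ≤ 1 := by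
      rw [jumpRatio, div_le_one (hpos (k + 1) hk'), abs_le]
      constructor <;> linarith [hpos k (by omega), hdrop k hk']
    by_cases hp : k = n - 1
    · rw [if_pos hp]; split_ifs <;> linarith
    by_cases hq : k = 2 * n - 1
    · rw [if_pos hq]; split_ifs; linarith
    have heq : x (k + 2) - x (k + 1) = x (k + 1) - x k := by
      rw [hw k (by omega), hw (k + 1) hk']
      split_ifs <;> first | omega | rfl
    rw [if_neg hp, if_neg hq, jumpRatio, heq]
    simp
  refine (Finset.sum_le_sum hle).trans ?_
  rw [Finset.sum_add_distrib, Finset.sum_ite_eq', Finset.sum_ite_eq']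
  split_ifs <;> norm_num

lemma exp_sub_exp_le {α ε L s t N : ℝ} (hα : 0 < α) (hε : 0 < ε) (hL : 1 ≤ L)
    (hLN : Real.log N = L) (hN : 1 ≤ N) (hs : 0 ≤ s)
    (h : α * (t - s) ≤ 8 * ε * L / N ∨ 2 * ε / α * L ≤ s) :
    Real.exp (-(α * s / ε)) - Real.exp (-(α * t / ε)) ≤ 8 * (L / N) := by
  have hN0 : 0 < N := by linarith
  rcases h with h | h
  · have e : Real.exp (-(α * t / ε))
        = Real.exp (-(α * s / ε)) * Real.exp (-(α * (t - s) / ε)) := by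
      rw [← Real.exp_add]; congr 1; ring
    have h1 := Real.add_one_le_exp (-(α * (t - s) / ε))
    have h2 : Real.exp (-(α * s / ε)) ≤ 1 := by
      rw [Real.exp_le_one_iff, neg_nonpos]; positivity
    have h3 : α * (t - s) / ε ≤ 8 * (L / N) := by
      rw [div_le_iff₀ hε]
      calc _ ≤ _ := h
        _ = _ := by ring
    have h4 : 0 ≤ 8 * (L / N) := by positivity
    have h5 : 0 < Real.exp (-(α * s / ε)) := Real.exp_pos _
    rw [e]
    calc Real.exp (-(α * s / ε)) - Real.exp (-(α * s / ε)) * Real.exp (-(α * (t - s) / ε))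
        = Real.exp (-(α * s / ε)) * (1 - Real.exp (-(α * (t - s) / ε))) := by ring
      _ ≤ Real.exp (-(α * s / ε)) * (8 * (L / N)) :=
          mul_le_mul_of_nonneg_left (by linarith) h5.le
      _ ≤ 8 * (L / N) := mul_le_of_le_one_left h4 h2
  · have h1 : 2 * L ≤ α * s / ε := by
      rw [le_div_iff₀ hε]
      calc 2 * L * ε = α * (2 * ε / α * L) := by field_simp
        _ ≤ α * s := mul_le_mul_of_nonneg_left h hα.le
    have h2 : Real.exp (-(α * s / ε)) ≤ 1 / N := by
      calc Real.exp (-(α * s / ε)) ≤ Real.exp (-L) := Real.exp_le_exp.2 (by linarith)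
        _ = 1 / N := by rw [Real.exp_neg, ← hLN, Real.exp_log hN0, one_div]
    have h3 : 1 / N ≤ L / N := div_le_div_of_nonneg_right hL hN0.le
    have h4 : 0 ≤ L / N := by positivity
    linarith [Real.exp_pos (-(α * t / ε))]

lemma one_le_log_of_four_le {N : ℕ} (hN : 4 ≤ N) : 1 ≤ Real.log N := by
  rw [Real.le_log_iff_exp_le (by positivity)]
  have : (4:ℝ) ≤ N := by exact_mod_cast hN
  linarith [Real.exp_one_lt_d9]

/-- Properties of the Shishkin mesh: it is a layer mesh, its widths are `O(1/N)`, and both layer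
functions vary by `O(log N / N)` over each mesh interval. -/
lemma shMesh_properties {N : ℕ} {α ε₁ ε₂ : ℝ} (hα : 0 < α) (hε₁ : 0 < ε₁) (h12 : ε₁ < ε₂)
    (hN : 4 ≤ N) (h4 : 4 ∣ N) :
    IsLayerMesh N (shMesh N α ε₁ ε₂) ∧ ∀ k, k < N →
      shMesh N α ε₁ ε₂ (k + 1) - shMesh N α ε₁ ε₂ k ≤ 2 * (Real.log N / N) ∧
      ∀ ε, ε = ε₁ ∨ ε = ε₂ → Real.exp (-(α * shMesh N α ε₁ ε₂ k / ε))
        - Real.exp (-(α * shMesh N α ε₁ ε₂ (k + 1) / ε)) ≤ 8 * (Real.log N / N) := by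
  obtain ⟨n, rfl⟩ := h4
  have hn : 1 ≤ n := by omega
  have hn0 : (0:ℝ) < n := by exact_mod_cast hn
  have hε₂ : 0 < ε₂ := hε₁.trans h12
  obtain ⟨L, hL⟩ : ∃ L, L = Real.log ((4 * n : ℕ) : ℝ) := ⟨_, rfl⟩
  have hL1 : 1 ≤ L := hL ▸ one_le_log_of_four_le hN
  have hNr : ((4 * n : ℕ) : ℝ) = 4 * n := by push_cast; ring
  obtain ⟨σ₁, hσ₁⟩ : ∃ σ, σ = 2 * ε₁ / α * L := ⟨_, rfl⟩
  obtain ⟨σ₂, hσ₂⟩ : ∃ σ, σ = 2 * ε₂ / α * L := ⟨_, rfl⟩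
  obtain ⟨τ₂, hτ₂⟩ : ∃ τ, τ = min (1 / 2) σ₂ := ⟨_, rfl⟩
  obtain ⟨τ₁, hτ₁⟩ : ∃ τ, τ = min (τ₂ / 2) σ₁ := ⟨_, rfl⟩
  have hσ₁0 : 0 < σ₁ := by rw [hσ₁]; positivity
  have hσ₁₂ : σ₁ ≤ σ₂ := by rw [hσ₁, hσ₂]; gcongr
  have hτ₂h : τ₂ ≤ 1 / 2 := hτ₂ ▸ min_le_left _ _
  have hτ₂σ : τ₂ ≤ σ₂ := hτ₂ ▸ min_le_right _ _
  have hτ₂0 : 0 < τ₂ := by rw [hτ₂]; exact lt_min (by norm_num) (by linarith)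
  have hτ₁h : τ₁ ≤ τ₂ / 2 := hτ₁ ▸ min_le_left _ _
  have hτ₁σ : τ₁ ≤ σ₁ := hτ₁ ▸ min_le_right _ _
  have hτ₁0 : 0 < τ₁ := by rw [hτ₁]; exact lt_min (by linarith) hσ₁0
  have hx : ∀ j, shMesh (4 * n) α ε₁ ε₂ j = if j ≤ n then (j : ℝ) * (τ₁ / n)
      else if j ≤ 2 * n then τ₁ + ((j : ℝ) - n) * ((τ₂ - τ₁) / n)
      else τ₂ + ((j : ℝ) - 2 * n) * ((1 - τ₂) / (2 * n)) := by
    intro j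
    have e1 : 4 * n / 4 = n := by omega
    have e2 : 4 * n / 2 = 2 * n := by omega
    simp only [shMesh, e1, e2, ← hL, ← hσ₁, ← hσ₂, ← hτ₂, ← hτ₁]
    have e3 : 4 * τ₁ / (4 * (n:ℝ)) = τ₁ / n := by field_simp
    have e4 : 4 * (τ₂ - τ₁) / (4 * (n:ℝ)) = (τ₂ - τ₁) / n := by field_simp
    have e5 : 2 * (1 - τ₂) / (4 * (n:ℝ)) = (1 - τ₂) / (2 * n) := by field_simp; ring
    have e6 : 4 * (n:ℝ) / 4 = n := by field_simp
    have e7 : 4 * (n:ℝ) / 2 = 2 * n := by field_simp; norm_num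
    rw [hNr, e3, e4, e5, e6, e7]
  rw [← hL]
  generalize shMesh (4 * n) α ε₁ ε₂ = x at hx
  have hxn : x n = τ₁ := by
    rw [hx, if_pos le_rfl]; field_simp
  have hx2n : x (2 * n) = τ₂ := by
    rw [hx, if_neg (by omega), if_pos le_rfl]; push_cast; field_simp; ring
  have hw : ∀ j, j < 4 * n → x (j + 1) - x j = if j < n then τ₁ / n else
      if j < 2 * n then (τ₂ - τ₁) / n else (1 - τ₂) / (2 * n) := by
    intro j hj
    rcases lt_trichotomy j n with h | rfl | h
    · rw [hx, hx, if_pos (by omega), if_pos (by omega), if_pos h]; push_cast; ring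
    · rw [hxn, hx, if_neg (by omega), if_pos (by omega), if_neg (by omega), if_pos (by omega)]
      push_cast; ring
    · rcases lt_trichotomy j (2 * n) with h' | rfl | h'
      · rw [hx, hx, if_neg (by omega), if_pos (by omega), if_neg (by omega), if_pos (by omega),
          if_neg (by omega), if_pos (by omega)]
        push_cast; ring
      · rw [hx2n, hx, if_neg (by omega), if_neg (by omega), if_neg (by omega), if_neg (by omega)]
        push_cast; ring
      · rw [hx, hx, if_neg (by omega), if_neg (by omega), if_neg (by omega), if_neg (by omega),
          if_neg (by omega), if_neg (by omega)]
        push_cast; ring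
  have hmesh : IsLayerMesh (4 * n) x := by
    refine isLayerMesh_of_widths (w₁ := τ₁ / n) (w₂ := (τ₂ - τ₁) / n) (w₃ := (1 - τ₂) / (2 * n))
      (by positivity) ?_ (div_pos (by linarith) (by positivity)) ?_ ?_ ?_ hw
    · gcongr; linarith
    · rw [show 2 * ((1 - τ₂) / (2 * (n:ℝ))) = (1 - τ₂) / n by field_simp]
      exact div_le_div_of_nonneg_right (by linarith) hn0.le
    · rw [hx, if_pos (by omega)]; simp
    · rw [hx, if_neg (by omega), if_neg (by omega)]; push_cast; field_simp; ring
  refine ⟨hmesh, fun k hk => ?_⟩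
  have hLn : L / ((4 * n : ℕ) : ℝ) = L / 4 / n := by rw [hNr]; field_simp
  have hdiv : ∀ {p q : ℝ}, p ≤ q → p / n ≤ q / n := fun h => div_le_div_of_nonneg_right h hn0.le
  have hw₃ : (1 - τ₂) / (2 * (n:ℝ)) = (1 - τ₂) / 2 / n := by field_simp
  refine ⟨?_, fun ε hε => ?_⟩
  · rw [hLn, hw k hk, ← mul_div_assoc, hw₃]
    split_ifs <;> exact hdiv (by linarith)
  · have hε0 : 0 < ε := by rcases hε with rfl | rfl <;> assumption
    refine exp_sub_exp_le hα hε0 hL1 hL.symm (by rw [hNr]; norm_cast; omega)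
      (hmesh.mem_Icc hk.le).1 ?_
    -- A width `c / n` with `c ≤ σ` resolves the layer with transition parameter `σ`.
    have hfine : ∀ {c : ℝ}, x (k + 1) - x k = c / n → c ≤ 2 * ε / α * L →
        α * (x (k + 1) - x k) ≤ 8 * ε * L / ((4 * n : ℕ) : ℝ) := by
      intro c hc hcσ
      rw [hc, hNr]
      calc α * (c / n) = α * c / n := by ring
        _ ≤ α * (2 * ε / α * L) / n := hdiv (mul_le_mul_of_nonneg_left hcσ hα.le)
        _ = _ := by field_simp; ring
    have hwk := hw k hk
    by_cases hk1 : k < n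
    · rw [if_pos hk1] at hwk
      refine Or.inl (hfine hwk ?_)
      rcases hε with rfl | rfl
      · rw [← hσ₁]; exact hτ₁σ
      · rw [← hσ₂]; linarith
    have hxk : τ₁ ≤ x k := hxn ▸ hmesh.le_of_le (by omega) hk.le
    by_cases hk2 : k < 2 * n
    · rw [if_neg hk1, if_pos hk2] at hwk
      rcases hε with rfl | rfl
      · rw [← hσ₁]
        rcases le_total (τ₂ / 2) σ₁ with h | h
        · rw [min_eq_left h] at hτ₁
          exact Or.inl (hfine hwk (by rw [← hσ₁]; linarith))
        · rw [min_eq_right h] at hτ₁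
          exact Or.inr (by linarith)
      · exact Or.inl (hfine hwk (by rw [← hσ₂]; linarith))
    have hxk2 : τ₂ ≤ x k := hx2n ▸ hmesh.le_of_le (by omega) hk.le
    rw [if_neg hk1, if_neg hk2, hw₃] at hwk
    rcases le_total (1 / 2) σ₂ with h2 | h2
    · rw [min_eq_left h2] at hτ₂
      rcases hε with rfl | rfl
      · rcases le_total (τ₂ / 2) σ₁ with h | h
        · exact Or.inl (hfine hwk (by rw [← hσ₁]; linarith))
        · rw [min_eq_right h] at hτ₁
          exact Or.inr (by rw [← hσ₁]; linarith)
      · exact Or.inl (hfine hwk (by rw [← hσ₂]; linarith))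
    · rw [min_eq_right h2] at hτ₂
      refine Or.inr ?_
      rcases hε with rfl | rfl
      · rw [← hσ₁]; linarith
      · rw [← hσ₂]; linarith

lemma exists_common_bound (S : List (ℝ → ℝ)) (hS : ∀ F ∈ S, ContDiff ℝ 4 F) :
    ∃ B : ℝ, ∀ F ∈ S, ∀ x ∈ Icc (0:ℝ) 1, |F x| ≤ B ∧ |deriv F x| ≤ B := by
  induction S with
  | nil => exact ⟨0, by simp⟩
  | cons F S ih =>
    obtain ⟨B, hB⟩ := ih fun F' h => hS F' (List.mem_cons_of_mem _ h)
    have hF := hS F List.mem_cons_self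
    obtain ⟨B₁, hB₁⟩ := isCompact_Icc.exists_bound_of_continuousOn (s := Icc (0:ℝ) 1)
      hF.continuous.continuousOn
    obtain ⟨B₂, hB₂⟩ := isCompact_Icc.exists_bound_of_continuousOn (s := Icc (0:ℝ) 1)
      (hF.continuous_deriv (by norm_num)).continuousOn
    refine ⟨max B (max B₁ B₂), fun F' hF' x hx => ?_⟩
    rcases List.mem_cons.1 hF' with rfl | h
    · exact ⟨(hB₁ x hx).trans (by simp), (hB₂ x hx).trans (by simp)⟩
    · exact ⟨(hB F' h x hx).1.trans (le_max_left _ _), (hB F' h x hx).2.trans (le_max_left _ _)⟩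

lemma differentiable_deriv_of_contDiff_three {u : ℝ → ℝ} (hu : ContDiff ℝ 3 u) :
    Differentiable ℝ u ∧ Differentiable ℝ (deriv u) ∧ Continuous (deriv (deriv u)) := by
  have h1 : ContDiff ℝ 2 (deriv u) :=
    ((contDiff_succ_iff_deriv (n := 2)).1 (by norm_num; exact hu)).2.2
  have h2 : ContDiff ℝ 1 (deriv (deriv u)) :=
    ((contDiff_succ_iff_deriv (n := 1)).1 (by norm_num; exact h1)).2.2
  exact ⟨hu.differentiable (by norm_num), h1.differentiable (by norm_num), h2.continuous⟩

/-- A differential equation with continuous data on the open interval holds up to the boundary. -/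
lemma ode_on_Icc {ε : ℝ} {a b c f u v : ℝ → ℝ} (hu : ContDiff ℝ 3 u) (hv : Continuous v)
    (ha : Continuous a) (hb : Continuous b) (hc : Continuous c) (hf : Continuous f)
    (heq : ∀ x ∈ Ioo (0:ℝ) 1,
      ε * deriv (deriv u) x + a x * deriv u x - b x * u x + c x * v x = f x) :
    ∀ x ∈ Icc (0:ℝ) 1,
      ε * deriv (deriv u) x + a x * deriv u x = f x + b x * u x - c x * v x := by
  obtain ⟨h1, h2, h3⟩ := differentiable_deriv_of_contDiff_three hu
  have hu0 := h1.continuous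
  have hu1 := h2.continuous
  have hE : EqOn (fun x => ε * deriv (deriv u) x + a x * deriv u x)
      (fun x => f x + b x * u x - c x * v x) (Ioo 0 1) := fun x hx => by
    have := heq x hx
    simp only
    linarith
  have := hE.closure (by fun_prop) (by fun_prop)
  rw [closure_Ioo (by norm_num)] at this
  exact fun x hx => this hx

/-- The truncation error of one component of the system has small weighted partial sums on any
layer mesh over whose intervals the majorant `m` varies little. -/
lemma abs_sum_residual_le {N : ℕ} {x : ℕ → ℝ} (hx : IsLayerMesh N x) {ε η B K G Y : ℝ}
    {a b c f u v m m' : ℝ → ℝ} (hu : ContDiff ℝ 3 u) (hv : Differentiable ℝ v)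
    (ha : Differentiable ℝ a) (hb : Differentiable ℝ b) (hc : Differentiable ℝ c)
    (hf : Differentiable ℝ f)
    (hBa : ∀ x ∈ Icc (0:ℝ) 1, |a x| ≤ B ∧ |deriv a x| ≤ B)
    (hBb : ∀ x ∈ Icc (0:ℝ) 1, |b x| ≤ B ∧ |deriv b x| ≤ B)
    (hBc : ∀ x ∈ Icc (0:ℝ) 1, |c x| ≤ B ∧ |deriv c x| ≤ B)
    (hBf : ∀ x ∈ Icc (0:ℝ) 1, |f x| ≤ B ∧ |deriv f x| ≤ B)
    (hK : ∀ x ∈ Icc (0:ℝ) 1, |u x| ≤ K ∧ |v x| ≤ K)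
    (hG : ∀ x ∈ Icc (0:ℝ) 1, |f x + b x * u x - c x * v x| ≤ G)
    (hm : ∀ x, HasDerivAt m (m' x) x) (hm1 : ∀ x ∈ Icc (0:ℝ) 1, 1 ≤ m' x)
    {p : ℝ → ℝ} (hup : ∀ x ∈ Icc (0:ℝ) 1, |deriv u x| ≤ p x)
    (hvp : ∀ x ∈ Icc (0:ℝ) 1, |deriv v x| ≤ p x)
    (hpm : ∀ x ∈ Icc (0:ℝ) 1, p x ≤ m' x)
    (hpm' : ∀ x ∈ Icc (0:ℝ) 1, B + 2 * (B * K) + 2 * (B * p x) ≤ m' x)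
    (heq : ∀ x ∈ Icc (0:ℝ) 1,
      ε * deriv (deriv u) x + a x * deriv u x = f x + b x * u x - c x * v x)
    (hη : ∀ k, k < N → m (x (k + 1)) - m (x k) ≤ η) (hη0 : 0 ≤ η)
    {U V : ℕ → ℝ} (hU : ∀ j, 1 ≤ j → j < N → LN1 ε a b c x U V j = f (x j))
    (hY : Y = 6 * (1 + B + G + B) * η) :
    ∀ j, j < N → |∑ k ∈ Finset.range j, (x (k + 2) - x k) / 2 *
      LN1 ε a b c x (fun i => U i - u (x i)) (fun i => V i - v (x i)) (k + 1)| ≤ Y := by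
  obtain ⟨h1, h2, -⟩ := differentiable_deriv_of_contDiff_three hu
  have hg' : ∀ y, HasDerivAt (fun x => f x + b x * u x - c x * v x)
      (deriv f y + (deriv b y * u y + b y * deriv u y) - (deriv c y * v y + c y * deriv v y)) y :=
    fun y => ((hf y).hasDerivAt.add ((hb y).hasDerivAt.mul (h1 y).hasDerivAt)).sub
      ((hc y).hasDerivAt.mul (hv y).hasDerivAt)
  intro j hj
  have key := abs_sum_truncation_le hx h1 h2 ha (fun y => (hg' y).differentiableAt)
    (fun y hy => (hBa y hy).1) (fun y hy => (hBa y hy).2) hG hm hm1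
    (fun y hy => (hup y hy).trans (hpm y hy)) (fun y hy => ?_) heq hη hη0 j hj
  · rw [hY]
    refine le_of_eq_of_le ?_ key
    congr 1
    refine Finset.sum_congr rfl fun k hk => ?_
    have hk' := Finset.mem_range.1 hk
    rw [LN1_sub, hU (k + 1) (by omega) (by omega)]
    simp only [LN1]
    ring
  · rw [(hg' y).deriv]
    refine le_trans ?_ (hpm' y hy)
    have hB : 0 ≤ B := (abs_nonneg _).trans (hBa y hy).1
    have e1 : |deriv b y * u y| ≤ B * K := by
      rw [abs_mul]; exact mul_le_mul (hBb y hy).2 (hK y hy).1 (abs_nonneg _) hB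
    have e2 : |b y * deriv u y| ≤ B * p y := by
      rw [abs_mul]; exact mul_le_mul (hBb y hy).1 (hup y hy) (abs_nonneg _) hB
    have e3 : |deriv c y * v y| ≤ B * K := by
      rw [abs_mul]; exact mul_le_mul (hBc y hy).2 (hK y hy).2 (abs_nonneg _) hB
    have e4 : |c y * deriv v y| ≤ B * p y := by
      rw [abs_mul]; exact mul_le_mul (hBc y hy).1 (hvp y hy) (abs_nonneg _) hB
    have e5 := (hBf y hy).2
    rw [abs_le] at *
    constructor <;> linarith [e1.1, e1.2, e2.1, e2.2, e3.1, e3.2, e4.1, e4.2, e5.1, e5.2]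

lemma abs_source_le {B K b c f u v : ℝ} (hb : |b| ≤ B) (hc : |c| ≤ B) (hf : |f| ≤ B)
    (hu : |u| ≤ K) (hv : |v| ≤ K) : |f + b * u - c * v| ≤ B + 2 * (B * K) := by
  have hB : 0 ≤ B := (abs_nonneg _).trans hb
  have e1 : |b * u| ≤ B * K := by
    rw [abs_mul]; exact mul_le_mul hb hu (abs_nonneg _) hB
  have e2 : |c * v| ≤ B * K := by
    rw [abs_mul]; exact mul_le_mul hc hv (abs_nonneg _) hB
  rw [abs_le] at e1 e2 hf ⊢
  constructor <;> linarith [e1.1, e1.2, e2.1, e2.2, hf.1, hf.2]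

lemma hasDerivAt_layer_primitive {α ε : ℝ} (hα : 0 < α) (y : ℝ) :
    HasDerivAt (fun x => -(Real.exp (-(α * x / ε)) / α)) (ε⁻¹ * Real.exp (-(α * y / ε))) y := by
  have h1 : HasDerivAt (fun x : ℝ => -(α * x / ε)) (-(α * 1 / ε)) y :=
    (((hasDerivAt_id y).const_mul α).div_const ε).neg
  refine (h1.exp.div_const α).neg.congr_deriv ?_
  field_simp

/-- Main theorem: essentially first-order parameter-uniform convergence of the
upwind scheme on the Shishkin mesh. -/
theorem parameter_uniform_convergence
    (α β : ℝ) (a₁ a₂ b₁₁ b₁₂ b₂₁ b₂₂ f₁ f₂ : ℝ → ℝ) (l₁ l₂ r₁ r₂ : ℝ)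
    (hα : 0 < α) (hβ : 0 < β)
    (ha₁s : ContDiff ℝ 4 a₁) (ha₂s : ContDiff ℝ 4 a₂)
    (hb₁₁s : ContDiff ℝ 4 b₁₁) (hb₁₂s : ContDiff ℝ 4 b₁₂)
    (hb₂₁s : ContDiff ℝ 4 b₂₁) (hb₂₂s : ContDiff ℝ 4 b₂₂)
    (hf₁s : ContDiff ℝ 4 f₁) (hf₂s : ContDiff ℝ 4 f₂)
    (ha₁ : ∀ x ∈ Icc (0:ℝ) 1, α ≤ a₁ x) (ha₂ : ∀ x ∈ Icc (0:ℝ) 1, α ≤ a₂ x)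
    (hb₁ : ∀ x ∈ Icc (0:ℝ) 1, β ≤ b₁₁ x - b₁₂ x)
    (hb₂ : ∀ x ∈ Icc (0:ℝ) 1, β ≤ b₂₂ x - b₂₁ x)
    (hb₁₂ : ∀ x ∈ Icc (0:ℝ) 1, 0 < b₁₂ x) (hb₂₁ : ∀ x ∈ Icc (0:ℝ) 1, 0 < b₂₁ x) :
    ∃ C : ℝ, 0 < C ∧
      ∀ ε₁ ε₂ : ℝ, 0 < ε₁ → ε₁ < ε₂ → ε₂ ≤ 1 →
      ∀ N : ℕ, 4 ≤ N → 4 ∣ N →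
      ∀ u₁ u₂ : ℝ → ℝ, ContDiff ℝ 3 u₁ → ContDiff ℝ 3 u₂ →
        (∀ x ∈ Ioo (0:ℝ) 1,
          ε₁ * deriv (deriv u₁) x + a₁ x * deriv u₁ x - b₁₁ x * u₁ x + b₁₂ x * u₂ x
            = f₁ x ∧
          ε₂ * deriv (deriv u₂) x + a₂ x * deriv u₂ x - b₂₂ x * u₂ x + b₂₁ x * u₁ x
            = f₂ x) →
        u₁ 0 = l₁ → u₂ 0 = l₂ → u₁ 1 = r₁ → u₂ 1 = r₂ →
        ∀ U₁ U₂ : ℕ → ℝ,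
          (∀ j, 1 ≤ j → j < N →
            LN1 ε₁ a₁ b₁₁ b₁₂ (shMesh N α ε₁ ε₂) U₁ U₂ j = f₁ (shMesh N α ε₁ ε₂ j) ∧
            LN2 ε₂ a₂ b₂₂ b₂₁ (shMesh N α ε₁ ε₂) U₁ U₂ j = f₂ (shMesh N α ε₁ ε₂ j)) →
          U₁ 0 = l₁ → U₂ 0 = l₂ → U₁ N = r₁ → U₂ N = r₂ →
          ∀ j ≤ N,
            |U₁ j - u₁ (shMesh N α ε₁ ε₂ j)| ≤ C * Real.log (N : ℝ) / N ∧
            |U₂ j - u₂ (shMesh N α ε₁ ε₂ j)| ≤ C * Real.log (N : ℝ) / N := by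
  obtain ⟨B, hB⟩ := exists_common_bound [a₁, a₂, b₁₁, b₁₂, b₂₁, b₂₂, f₁, f₂]
    (by simp only [List.forall_mem_cons]; simp [*])
  simp only [List.forall_mem_cons] at hB
  obtain ⟨hBa₁, hBa₂, hBb₁₁, hBb₁₂, hBb₂₁, hBb₂₂, hBf₁, hBf₂, -⟩ := hB
  have hB0 : 0 ≤ B := (abs_nonneg _).trans (hBa₁ 0 (by simp)).1
  obtain ⟨K, hK⟩ : ∃ K, K = |l₁| + |l₂| + |r₁| + |r₂| + B / β := ⟨_, rfl⟩
  have hK0 : 0 ≤ K := by rw [hK]; positivity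
  obtain ⟨G, hG⟩ : ∃ G, G = B + 2 * (B * K) := ⟨_, rfl⟩
  have hG0 : 0 ≤ G := by rw [hG]; positivity
  obtain ⟨Q, hQ⟩ : ∃ Q, Q = 2 * K + 2 * (B * K) + G + B * K := ⟨_, rfl⟩
  have hQ0 : 0 ≤ Q := by rw [hQ]; positivity
  obtain ⟨R, hR⟩ : ∃ R, R = (G + 1) / α := ⟨_, rfl⟩
  have hR0 : 0 ≤ R := by rw [hR]; positivity
  obtain ⟨D, hD⟩ : ∃ D, D = 1 + Q + R + G + 2 * (B * R) + 2 * (B * Q) := ⟨_, rfl⟩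
  have hD0 : 0 ≤ D := by rw [hD]; positivity
  have hBR : 0 ≤ B * R := mul_nonneg hB0 hR0
  have hBQ : 0 ≤ B * Q := mul_nonneg hB0 hQ0
  refine ⟨(6 / α + 2 * B / α ^ 2) * (6 * (1 + B + G + B) * (D * (2 + 16 / α)))
    * (2 + 2 * B / β) + 1, by positivity, ?_⟩
  intro ε₁ ε₂ hε₁ h12 hε₂1 N hN h4 u₁ u₂ hu₁ hu₂ heq hl₁ hl₂ hr₁ hr₂ U₁ U₂ hU hU₁0 hU₂0 hU₁N hU₂N
  have hε₂ : 0 < ε₂ := hε₁.trans h12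
  obtain ⟨hmesh, hinc⟩ := shMesh_properties hα hε₁ h12 hN h4
  generalize shMesh N α ε₁ ε₂ = x at hmesh hinc hU
  have hL : 0 ≤ Real.log N / N := div_nonneg (by linarith [one_le_log_of_four_le hN]) (by positivity)
  have hBβ : 0 ≤ B / β := by positivity
  have hbound := abs_solution_le (K := K) hβ hε₁ hε₂ hu₁.continuous hu₂.continuous hb₁ hb₂ hb₁₂ hb₂₁
    (fun y hy => (hBf₁ y hy).1) (fun y hy => (hBf₂ y hy).1) heq
    (by rw [hl₁, hK]; linarith [abs_nonneg l₁, abs_nonneg l₂, abs_nonneg r₁, abs_nonneg r₂])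
    (by rw [hl₂, hK]; linarith [abs_nonneg l₁, abs_nonneg l₂, abs_nonneg r₁, abs_nonneg r₂])
    (by rw [hr₁, hK]; linarith [abs_nonneg l₁, abs_nonneg l₂, abs_nonneg r₁, abs_nonneg r₂])
    (by rw [hr₂, hK]; linarith [abs_nonneg l₁, abs_nonneg l₂, abs_nonneg r₁, abs_nonneg r₂])
    (by rw [hK]; linarith [abs_nonneg l₁, abs_nonneg l₂, abs_nonneg r₁, abs_nonneg r₂])
  have hode₁ := ode_on_Icc hu₁ hu₂.continuous ha₁s.continuous hb₁₁s.continuous hb₁₂s.continuous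
    hf₁s.continuous fun y hy => (heq y hy).1
  have hode₂ := ode_on_Icc hu₂ hu₁.continuous ha₂s.continuous hb₂₂s.continuous hb₂₁s.continuous
    hf₂s.continuous fun y hy => (heq y hy).2
  have hg₁ : ∀ y ∈ Icc (0:ℝ) 1, |f₁ y + b₁₁ y * u₁ y - b₁₂ y * u₂ y| ≤ G := fun y hy =>
    hG ▸ abs_source_le (hBb₁₁ y hy).1 (hBb₁₂ y hy).1 (hBf₁ y hy).1 (hbound y hy).1 (hbound y hy).2
  have hg₂ : ∀ y ∈ Icc (0:ℝ) 1, |f₂ y + b₂₂ y * u₂ y - b₂₁ y * u₁ y| ≤ G := fun y hy =>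
    hG ▸ abs_source_le (hBb₂₂ y hy).1 (hBb₂₁ y hy).1 (hBf₂ y hy).1 (hbound y hy).2 (hbound y hy).1
  have hd : ∀ {F : ℝ → ℝ}, ContDiff ℝ 4 F → Differentiable ℝ F :=
    fun h => h.differentiable (by norm_num)
  obtain ⟨hd₁, hd₁', -⟩ := differentiable_deriv_of_contDiff_three hu₁
  obtain ⟨hd₂, hd₂', -⟩ := differentiable_deriv_of_contDiff_three hu₂
  have hlayer₁ := abs_deriv_le_layer hα hε₁ (h12.le.trans hε₂1) hd₁ hd₁' (hd ha₁s) ha₁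
    (fun y hy => (hBa₁ y hy).1) (fun y hy => (hBa₁ y hy).2) hg₁ (fun y hy => (hbound y hy).1) hode₁
  have hlayer₂ := abs_deriv_le_layer hα hε₂ hε₂1 hd₂ hd₂' (hd ha₂s) ha₂
    (fun y hy => (hBa₂ y hy).1) (fun y hy => (hBa₂ y hy).2) hg₂ (fun y hy => (hbound y hy).2) hode₂
  rw [← hQ, ← hR] at hlayer₁ hlayer₂
  obtain ⟨w₁, hw₁⟩ : ∃ w : ℝ → ℝ, w = fun y => ε₁⁻¹ * Real.exp (-(α * y / ε₁)) := ⟨_, rfl⟩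
  obtain ⟨w₂, hw₂⟩ : ∃ w : ℝ → ℝ, w = fun y => ε₂⁻¹ * Real.exp (-(α * y / ε₂)) := ⟨_, rfl⟩
  have hw₁0 : ∀ y, 0 ≤ w₁ y := fun y => by rw [hw₁]; positivity
  have hw₂0 : ∀ y, 0 ≤ w₂ y := fun y => by rw [hw₂]; positivity
  have hup : ∀ y ∈ Icc (0:ℝ) 1, |deriv u₁ y| ≤ Q * (w₁ y + w₂ y) + R := fun y hy => by
    have h1 := hlayer₁ y hy
    have h2 : w₁ y = ε₁⁻¹ * Real.exp (-(α * y / ε₁)) := by rw [hw₁]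
    rw [← h2] at h1
    linarith [mul_nonneg hQ0 (hw₂0 y)]
  have hvp : ∀ y ∈ Icc (0:ℝ) 1, |deriv u₂ y| ≤ Q * (w₁ y + w₂ y) + R := fun y hy => by
    have h1 := hlayer₂ y hy
    have h2 : w₂ y = ε₂⁻¹ * Real.exp (-(α * y / ε₂)) := by rw [hw₂]
    rw [← h2] at h1
    linarith [mul_nonneg hQ0 (hw₁0 y)]
  have hm : ∀ y, HasDerivAt (fun y => D * (y + (-(Real.exp (-(α * y / ε₁)) / α))
      + (-(Real.exp (-(α * y / ε₂)) / α)))) (D * (1 + w₁ y + w₂ y)) y := fun y => by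
    rw [hw₁, hw₂]
    exact (((hasDerivAt_id y).add (hasDerivAt_layer_primitive hα y)).add
      (hasDerivAt_layer_primitive hα y)).const_mul D
  have hm1 : ∀ y ∈ Icc (0:ℝ) 1, 1 ≤ D * (1 + w₁ y + w₂ y) := fun y _ => by
    have h1 : 1 ≤ D := by rw [hD]; linarith
    linarith [mul_nonneg hD0 (hw₁0 y), mul_nonneg hD0 (hw₂0 y)]
  have hpm : ∀ y ∈ Icc (0:ℝ) 1, Q * (w₁ y + w₂ y) + R ≤ D * (1 + w₁ y + w₂ y) := fun y _ => by
    have h1 : Q ≤ D := by rw [hD]; linarith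
    have h2 := mul_le_mul_of_nonneg_right h1 (add_nonneg (hw₁0 y) (hw₂0 y))
    have h3 : R ≤ D := by rw [hD]; linarith
    linarith
  have hpm' : ∀ y ∈ Icc (0:ℝ) 1, B + 2 * (B * K) + 2 * (B * (Q * (w₁ y + w₂ y) + R))
      ≤ D * (1 + w₁ y + w₂ y) := fun y _ => by
    have h1 : 2 * (B * Q) ≤ D := by rw [hD]; linarith
    have h2 := mul_le_mul_of_nonneg_right h1 (add_nonneg (hw₁0 y) (hw₂0 y))
    have h3 : G + 2 * (B * R) ≤ D := by rw [hD]; linarith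
    linarith
  have hη : ∀ k, k < N → D * (x (k + 1) + (-(Real.exp (-(α * x (k + 1) / ε₁)) / α))
        + (-(Real.exp (-(α * x (k + 1) / ε₂)) / α)))
      - D * (x k + (-(Real.exp (-(α * x k / ε₁)) / α)) + (-(Real.exp (-(α * x k / ε₂)) / α)))
      ≤ D * (2 + 16 / α) * (Real.log N / N) := fun k hk => by
    obtain ⟨h1, h2⟩ := hinc k hk
    have h3 := div_le_div_of_nonneg_right (h2 ε₁ (Or.inl rfl)) hα.le
    have h4 := div_le_div_of_nonneg_right (h2 ε₂ (Or.inr rfl)) hα.le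
    rw [sub_div] at h3 h4
    rw [← mul_sub, mul_assoc]
    refine mul_le_mul_of_nonneg_left ?_ hD0
    have h5 : (2 + 16 / α) * (Real.log N / N) = 2 * (Real.log N / N)
      + 8 * (Real.log N / N) / α + 8 * (Real.log N / N) / α := by ring
    rw [h5]
    linarith
  have hη0 : 0 ≤ D * (2 + 16 / α) * (Real.log N / N) := by positivity
  have hsum₁ := abs_sum_residual_le hmesh hu₁ hd₂ (hd ha₁s) (hd hb₁₁s) (hd hb₁₂s) (hd hf₁s)
    hBa₁ hBb₁₁ hBb₁₂ hBf₁ hbound hg₁ hm hm1 hup hvp hpm hpm' hode₁ hη hη0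
    (fun j h h' => (hU j h h').1) rfl
  have hsum₂ := abs_sum_residual_le hmesh hu₂ hd₁ (hd ha₂s) (hd hb₂₂s) (hd hb₂₁s) (hd hf₂s)
    hBa₂ hBb₂₂ hBb₂₁ hBf₂ (fun y hy => (hbound y hy).symm) hg₂ hm hm1 hvp hup hpm hpm' hode₂ hη hη0
    (fun j h h' => (hU j h h').2) rfl
  have herr := abs_error_le hmesh hα hβ hε₁ hε₂ (by positivity) (hd ha₁s) (hd ha₂s) ha₁ ha₂
    (fun y hy => (hBa₁ y hy).2) (fun y hy => (hBa₂ y hy).2) hb₁ hb₂ hb₁₂ hb₂₁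
    (fun y hy => ⟨(hBb₁₁ y hy).1, (hBb₁₂ y hy).1⟩) (fun y hy => ⟨(hBb₂₂ y hy).1, (hBb₂₁ y hy).1⟩)
    (by rw [hmesh.zero, hU₁0, hl₁, sub_self]) (by rw [hmesh.zero, hU₂0, hl₂, sub_self])
    (by rw [hmesh.last, hU₁N, hr₁, sub_self]) (by rw [hmesh.last, hU₂N, hr₂, sub_self])
    hsum₁ hsum₂
  intro j hj
  have hfin : (6 / α + 2 * B / α ^ 2) * (6 * (1 + B + G + B) *
      (D * (2 + 16 / α) * (Real.log N / N))) * (2 + 2 * B / β) ≤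
      ((6 / α + 2 * B / α ^ 2) * (6 * (1 + B + G + B) * (D * (2 + 16 / α)))
        * (2 + 2 * B / β) + 1) * Real.log N / N := by
    refine (le_add_of_nonneg_right hL).trans (le_of_eq ?_)
    ring
  exact ⟨(herr j hj).1.trans hfin, (herr j hj).2.trans hfin⟩
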